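/- arXiv:2501.04501 — 5 statements merged into one kernel-verified Lean document; each statement's English description precedes it below -/
import Mathlib

section
/- Let g be simple, (e,h,f) an sl2-triple, and a good grading g = ⊕ g_δ with f ∈ g_{-2}, e ∈ g_2. For an isotropic subspace l ⊆ g_1, let n_l = l^{⊥,ω} ⊕ g_{≥2}, π_l : g* → n_l* the restriction map, and O_l^- the coadjoint N_l-orbit of -χ|_{n_l}. Then the fiber π_l⁻¹(O_l^-) equals -χ + ad*(k)χ ⊕ m^⊥, where k is any complement of l in l^{⊥,ω}; and the Slodowy slice S_f = -χ + [g,e]^⊥ is contained in π_l⁻¹(O_l^-). -/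
open Polynomial in
/-- For an `sl₂`-triple of operators, if `E F y = 0` and `E ^ N y = 0` then `y` and `F y` are killed
by explicit products of linear factors in `H`. -/
theorem aeval_prod_eq_zero_of_sl2 {V : Type*} [AddCommGroup V] [Module ℂ V]
    (E H F : Module.End ℂ V) (hHE : H * E = E * H + 2 • E) (hHF : H * F = F * H - 2 • F)
    (hEF : E * F = F * E + H) (N : ℕ) (y : V) (hy : E (F y) = 0) (hN : (E ^ N) y = 0) :
    aeval H (∏ j ∈ Finset.range N, (X + C (j : ℂ))) y = 0 ∧
      aeval H (∏ j ∈ Finset.range N, (X + C ((j : ℂ) + 2))) (F y) = 0 := by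
  have hHE' (x : V) : H (E x) = E (H x) + 2 • E x := LinearMap.congr_fun hHE x
  have hHF' (x : V) : H (F x) = F (H x) - 2 • F x := LinearMap.congr_fun hHF x
  have hcomm (j : ℕ) : E ^ (j + 1) * F = F * E ^ (j + 1) + (j + 1) • (E ^ j * (H + j • 1)) := by
    induction j with
    | zero => simp [hEF]
    | succ j ih =>
      have h1 : H * E ^ (j + 1) = E ^ (j + 1) * H + (2 * (j + 1)) • E ^ (j + 1) := by
        clear ih
        induction j with
        | zero => simp [hHE]
        | succ j ih =>
          rw [pow_succ, ← mul_assoc, ih, add_mul, mul_assoc, hHE]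
          simp only [mul_add, smul_mul_assoc, mul_smul_comm, ← mul_assoc, ← pow_succ]
          module
      rw [pow_succ' E (j + 1), mul_assoc, ih, mul_add, ← mul_assoc, hEF, mul_smul_comm,
        ← mul_assoc, ← pow_succ', add_mul, h1, mul_assoc F]
      simp only [mul_add, mul_smul_comm, mul_one, ← pow_succ']
      module
  induction N generalizing y with
  | zero =>
    have : y = 0 := by simpa using hN
    simp [this]
  | succ N ih =>
    have h1 := LinearMap.congr_fun (hcomm N) y
    have hEFy : (E ^ (N + 1) * F) y = 0 := by
      rw [pow_succ, mul_assoc]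
      simp [hy]
    rw [hEFy] at h1
    have h2 : (E ^ N) (H y + (N : ℂ) • y) = 0 := by
      have h3 : ((N : ℂ) + 1) • (E ^ N) (H y + (N : ℂ) • y) = 0 := by
        rw [h1]
        simp only [LinearMap.add_apply, Module.End.mul_apply, hN, map_zero, zero_add,
          LinearMap.smul_apply, Module.End.one_apply, map_add, map_nsmul, map_smul]
        module
      exact (smul_eq_zero.mp h3).resolve_left (by exact_mod_cast Nat.succ_ne_zero N)
    have hF : F (H y + (N : ℂ) • y) = H (F y) + ((N : ℂ) + 2) • F y := by
      rw [hHF', map_add, map_smul]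
      module
    have hE : E (F (H y + (N : ℂ) • y)) = 0 := by
      have h3 := hHE' (F y)
      rw [hy] at h3
      rw [hF, map_add, map_smul, hy]
      simpa using h3.symm
    obtain ⟨ha, hb⟩ := ih _ hE h2
    rw [hF] at hb
    rw [Finset.prod_range_succ, Finset.prod_range_succ, map_mul, map_mul, Module.End.mul_apply,
      Module.End.mul_apply]
    refine ⟨?_, ?_⟩
    · rw [← ha, map_add, aeval_X, aeval_C, LinearMap.add_apply, Module.algebraMap_end_apply]
    · rw [← hb, map_add, aeval_X, aeval_C, LinearMap.add_apply, Module.algebraMap_end_apply]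

open Polynomial in
/-- For an `sl₂`-triple of operators, the kernel of `E` meets the image of `F` trivially on locally
nilpotent vectors. -/
theorem eq_zero_of_mem_ker_of_mem_range_sl2 {V : Type*} [AddCommGroup V] [Module ℂ V]
    (E H F : Module.End ℂ V) (hHE : H * E = E * H + 2 • E) (hHF : H * F = F * H - 2 • F)
    (hEF : E * F = F * E + H) (M N : ℕ) (y : V) (hy : E (F y) = 0) (hN : (E ^ N) y = 0)
    (hM : (F ^ M) (F y) = 0) : F y = 0 := by
  have h1 := (aeval_prod_eq_zero_of_sl2 E H F hHE hHF hEF N y hy hN).2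
  have h2 := (aeval_prod_eq_zero_of_sl2 F (-H) E (by rw [neg_mul, hHF]; noncomm_ring)
    (by rw [neg_mul, hHE]; noncomm_ring) (by rw [hEF]; abel) M (F y) (by simp [hy]) hM).1
  have h3 : aeval H (∏ j ∈ Finset.range M, (-X + C (j : ℂ))) (F y) = 0 := by
    have hcomp : ∏ j ∈ Finset.range M, (-X + C (j : ℂ)) =
        (∏ j ∈ Finset.range M, (X + C (j : ℂ))).comp (-X) := by
      simp only [prod_comp, add_comp, X_comp, C_comp]
    rw [hcomp, aeval_comp, map_neg, aeval_X, h2]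
  have hco : IsCoprime (∏ j ∈ Finset.range N, (X + C ((j : ℂ) + 2)))
      (∏ j ∈ Finset.range M, (-X + C (j : ℂ))) := by
    refine IsCoprime.prod_left fun j _ => IsCoprime.prod_right fun k _ => ?_
    have hne : ((j : ℂ) + 2 + k) ≠ 0 := by exact_mod_cast (by omega : j + 2 + k ≠ 0)
    refine ⟨C ((j : ℂ) + 2 + k)⁻¹, C ((j : ℂ) + 2 + k)⁻¹, ?_⟩
    rw [← mul_add, show (X + C ((j : ℂ) + 2)) + (-X + C (k : ℂ)) = C ((j : ℂ) + 2 + k) by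
      simp only [C_add]; ring, ← C_mul, inv_mul_cancel₀ hne, C_1]
  obtain ⟨a, b, hab⟩ := hco
  have := LinearMap.congr_fun (congrArg (aeval H) hab) (F y)
  rw [map_add, map_mul, map_mul, LinearMap.add_apply, Module.End.mul_apply, Module.End.mul_apply,
    h1, h3, map_one] at this
  simpa using this.symm

/-- An invariant form on a Lie algebra with nondegenerate Killing form is compatible with every
grading. -/
theorem form_eq_zero_of_grading {g : Type*} [LieRing g] [LieAlgebra ℂ g] [FiniteDimensional ℂ g]
    [LieAlgebra.IsKilling ℂ g] (Φ : g →ₗ[ℂ] g →ₗ[ℂ] ℂ)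
    (hinv : ∀ x y z : g, Φ ⁅x, y⁆ z = Φ x ⁅y, z⁆) (gr : ℤ → Submodule ℂ g)
    (hdec : DirectSum.IsInternal fun δ : ℤ => gr δ)
    (hbr : ∀ δ₁ δ₂ : ℤ, ∀ x ∈ gr δ₁, ∀ y ∈ gr δ₂, ⁅x, y⁆ ∈ gr (δ₁ + δ₂))
    {a b : ℤ} (hab : a + b ≠ 0) {x y : g} (hx : x ∈ gr a) (hy : y ∈ gr b) : Φ x y = 0 := by
  let ε : (DirectSum ℤ fun δ => gr δ) ≃ₗ[ℂ] g :=
    LinearEquiv.ofBijective (DirectSum.coeLinearMap gr) hdec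
  let D : g →ₗ[ℂ] g :=
    DirectSum.toModule ℂ ℤ g (fun δ => (δ : ℂ) • (gr δ).subtype) ∘ₗ ε.symm.toLinearMap
  have hD {δ : ℤ} {z : g} (hz : z ∈ gr δ) : D z = (δ : ℂ) • z := by
    have : ε.symm z = DirectSum.lof ℂ ℤ (fun δ => gr δ) δ ⟨z, hz⟩ := by
      rw [LinearEquiv.symm_apply_eq]
      exact (DirectSum.coeLinearMap_lof gr δ ⟨z, hz⟩).symm
    simp [D, this]
  have htop (z : g) : z ∈ ⨆ δ, gr δ := by
    rw [hdec.submodule_iSup_eq_top]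
    trivial
  have hleib (u v : g) : D ⁅u, v⁆ = ⁅u, D v⁆ - ⁅v, D u⁆ := by
    induction htop u using Submodule.iSup_induction' with
    | zero => simp
    | add u u' _ _ ih ih' =>
      simp only [add_lie, map_add, lie_add, ih, ih']
      abel
    | mem i u hu =>
      induction htop v using Submodule.iSup_induction' with
      | zero => simp
      | add v v' _ _ ih ih' =>
        simp only [add_lie, map_add, lie_add, ih, ih']
        abel
      | mem j v hv =>
        rw [hD hu, hD hv, hD (hbr i j u hu v hv), lie_smul, lie_smul, ← lie_skew u v]
        push_cast
        module
  obtain ⟨d, hd⟩ := LieDerivation.IsKilling.exists_eq_ad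
    (⟨D, hleib⟩ : LieDerivation ℂ g g)
  have hd' (z : g) : ⁅d, z⁆ = D z := by
    simpa using LieDerivation.congr_fun hd z
  have h1 : Φ (D x) y = -Φ x (D y) := by
    rw [← hd', ← hd', ← lie_skew, map_neg, LinearMap.neg_apply, hinv]
  rw [hD hx, hD hy, map_smul, map_smul, LinearMap.smul_apply, smul_eq_mul, smul_eq_mul] at h1
  have h2 : ((a + b : ℤ) : ℂ) * Φ x y = 0 := by
    push_cast
    linear_combination h1
  exact (mul_eq_zero.mp h2).resolve_left (by exact_mod_cast hab)

/-- A homogeneous element of nonzero degree is `ad`-nilpotent on homogeneous vectors. -/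
theorem exists_ad_pow_eq_zero_of_grading {g : Type*} [LieRing g] [LieAlgebra ℂ g]
    [FiniteDimensional ℂ g] (gr : ℤ → Submodule ℂ g)
    (hdec : DirectSum.IsInternal fun δ : ℤ => gr δ)
    (hbr : ∀ δ₁ δ₂ : ℤ, ∀ x ∈ gr δ₁, ∀ y ∈ gr δ₂, ⁅x, y⁆ ∈ gr (δ₁ + δ₂))
    {p a : ℤ} (hp : p ≠ 0) {u x : g} (hu : u ∈ gr p) (hx : x ∈ gr a) :
    ∃ N : ℕ, ((LieAlgebra.ad ℂ g u) ^ N) x = 0 := by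
  have hmem (N : ℕ) : ((LieAlgebra.ad ℂ g u) ^ N) x ∈ gr (a + p * N) := by
    induction N with
    | zero => simpa using hx
    | succ N ih =>
      rw [pow_succ']
      have h1 : p + (a + p * N) = a + p * (N + 1 : ℕ) := by
        push_cast
        ring
      exact h1 ▸ hbr p _ u hu _ ih
  have hfin : {d | gr d ≠ ⊥}.Finite :=
    WellFoundedGT.finite_ne_bot_of_iSupIndep hdec.submodule_iSupIndep
  by_contra! hne
  refine Set.infinite_of_injective_forall_mem (f := fun N : ℕ => a + p * N) ?_ ?_ hfin
  · intro m n hmn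
    simpa [hp] using hmn
  · intro N hN
    exact hne N (by simpa [hN] using hmem N)

/-- The exponential sum of an operator `T` at a vector killed by `T ^ 2`. -/
theorem sum_factorial_inv_smul_pow {V : Type*} [AddCommGroup V] [Module ℂ V]
    (T : Module.End ℂ V) (x : V) (hT : T (T x) = 0) (K : ℕ) (hK : K = 0 → T x = 0) :
    ∑ k ∈ Finset.range (K + 1), ((k.factorial : ℂ))⁻¹ • ((T ^ k) x) = x + T x := by
  rcases K with _ | K
  · simp [hK rfl]
  · rw [Finset.sum_range_succ', Finset.sum_range_succ', Finset.sum_eq_zero]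
    · simp [add_comm]
    · intro k _
      have : (T ^ (k + 1 + 1)) x = 0 := by
        rw [pow_succ, pow_succ, Module.End.mul_apply, Module.End.mul_apply, hT, map_zero]
      rw [this, smul_zero]

/-- The filtration attached to a grading is multiplicative. -/
theorem lie_mem_iSup_of_grading {g : Type*} [LieRing g] [LieAlgebra ℂ g]
    (gr : ℤ → Submodule ℂ g)
    (hbr : ∀ δ₁ δ₂ : ℤ, ∀ x ∈ gr δ₁, ∀ y ∈ gr δ₂, ⁅x, y⁆ ∈ gr (δ₁ + δ₂))
    {a b c : ℤ} (habc : c ≤ a + b) {x y : g} (hx : x ∈ ⨆ d : ℤ, ⨆ _ : a ≤ d, gr d)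
    (hy : y ∈ ⨆ d : ℤ, ⨆ _ : b ≤ d, gr d) : ⁅x, y⁆ ∈ ⨆ d : ℤ, ⨆ _ : c ≤ d, gr d := by
  rw [← lie_skew]
  refine neg_mem ?_
  have h1 : ⨆ d : ℤ, ⨆ _ : a ≤ d, gr d ≤
      (⨆ d : ℤ, ⨆ _ : c ≤ d, gr d).comap (LieAlgebra.ad ℂ g y) := by
    refine iSup₂_le fun d hd x hx => ?_
    rw [Submodule.mem_comap, LieAlgebra.ad_apply, ← lie_skew]
    refine neg_mem ?_
    have h2 : ⨆ d : ℤ, ⨆ _ : b ≤ d, gr d ≤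
        (⨆ d : ℤ, ⨆ _ : c ≤ d, gr d).comap (LieAlgebra.ad ℂ g x) := by
      refine iSup₂_le fun d' hd' y hy => ?_
      have h3 : gr (d + d') ≤ ⨆ d : ℤ, ⨆ _ : c ≤ d, gr d :=
        le_iSup₂_of_le (d + d') (by omega) le_rfl
      exact h3 (hbr d d' x hx y hy)
    exact h2 hy
  exact h1 hx


/-- With `g` simple, `(e, h, f)` an `sl₂`-triple compatible with a good
grading (`f ∈ g_{-2}`, `e ∈ g₂`, `h ∈ g₀`), `l ⊆ g₁` isotropic, `n_l = l^⊥ ⊕ g_{≥2}`,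
`π_l : g* → n_l*` the restriction map and `O_l⁻` the coadjoint `N_l`-orbit of `-χ|_{n_l}`
(realized through exponentials since `N_l` is unipotent): the fiber `π_l⁻¹(O_l⁻)` equals
`-χ + ad*(k)χ ⊕ n_l^⊥`, where `k` is any complement of `l` in `l^⊥`; and the Slodowy
slice `S_f = -χ + [g, e]^⊥` is contained in `π_l⁻¹(O_l⁻)`.  Here `ad*(v)χ = -χ ∘ ad v`
and `n_l^⊥` is the annihilator of `n_l` in `g*`. -/
theorem statement6
    (g : Type*) [LieRing g] [LieAlgebra ℂ g] [FiniteDimensional ℂ g]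
    [LieAlgebra.IsSimple ℂ g]
    (Φ : g →ₗ[ℂ] g →ₗ[ℂ] ℂ)
    (hsymm : ∀ x y : g, Φ x y = Φ y x)
    (hinv : ∀ x y z : g, Φ ⁅x, y⁆ z = Φ x ⁅y, z⁆)
    (hnondeg : ∀ x : g, (∀ y : g, Φ x y = 0) → x = 0)
    (gr : ℤ → Submodule ℂ g)
    (hdec : DirectSum.IsInternal fun δ : ℤ => gr δ)
    (hbr : ∀ δ₁ δ₂ : ℤ, ∀ x ∈ gr δ₁, ∀ y ∈ gr δ₂, ⁅x, y⁆ ∈ gr (δ₁ + δ₂))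
    (e h f : g)
    (hsl2_he : ⁅h, e⁆ = (2 : ℤ) • e) (hsl2_hf : ⁅h, f⁆ = (-2 : ℤ) • f)
    (hsl2_ef : ⁅e, f⁆ = h)
    (hf : f ∈ gr (-2)) (he : e ∈ gr 2) (hh : h ∈ gr 0)
    (hgoodinj : ∀ δ : ℤ, 1 ≤ δ → ∀ x ∈ gr δ, ⁅f, x⁆ = 0 → x = 0)
    (hgoodsurj : ∀ δ : ℤ, δ ≤ 1 → ∀ y ∈ gr (δ - 2), ∃ x ∈ gr δ, ⁅f, x⁆ = y)
    (l : Submodule ℂ g) (hl : l ≤ gr 1)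
    (hliso : ∀ u ∈ l, ∀ v ∈ l, Φ f ⁅u, v⁆ = 0)
    (lperp : Submodule ℂ g)
    (hlperp : ∀ v : g, v ∈ lperp ↔ v ∈ gr 1 ∧ ∀ u ∈ l, Φ f ⁅v, u⁆ = 0)
    (nl : LieSubalgebra ℂ g)
    (hnl : nl.toSubmodule = lperp ⊔ (⨆ d : ℤ, ⨆ _ : (2 : ℤ) ≤ d, gr d))
    -- `k` is a complement of `l` inside `l^⊥`
    (kk : Submodule ℂ g) (hkk_inf : kk ⊓ l = ⊥) (hkk_sup : kk ⊔ l = lperp)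
    (K : ℕ) (hK : ∀ v : nl, (LieAlgebra.ad ℂ nl v) ^ (K + 1) = 0) :
    -- the restriction map `π_l : g* → n_l*` and the functional `χ = Φ f`
    let π : Module.Dual ℂ g →ₗ[ℂ] Module.Dual ℂ nl :=
      LinearMap.dualMap (nl.toSubmodule.subtype)
    let χbar : Module.Dual ℂ nl := (Φ f) ∘ₗ (nl.toSubmodule.subtype)
    let coad : nl → Module.End ℂ (Module.Dual ℂ nl) :=
      fun v => -(LinearMap.dualMap (LieAlgebra.ad ℂ nl v : nl →ₗ[ℂ] nl))
    -- the opposite orbit `O_l⁻ = Ad*(N_l)·(-χ̄)`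
    let Oneg : Set (Module.Dual ℂ nl) :=
      {ξ | ∃ v : nl, ξ = ∑ k ∈ Finset.range (K + 1),
        ((k.factorial : ℂ))⁻¹ • ((coad v ^ k) (-χbar))}
    -- (1) explicit description of the fiber:
    --     `π_l⁻¹(O_l⁻) = -χ + ad*(k)χ ⊕ n_l^⊥`
    ({ξ : Module.Dual ℂ g | π ξ ∈ Oneg}
      = {ξ : Module.Dual ℂ g | ∃ v ∈ kk, ∃ η ∈ Submodule.dualAnnihilator nl.toSubmodule,
          ξ = -(Φ f) - (Φ f) ∘ₗ (LieAlgebra.ad ℂ g v : g →ₗ[ℂ] g) + η}) ∧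
    -- (2) the Slodowy slice `S_f = -χ + [g, e]^⊥` is contained in the fiber
    (∀ η ∈ Submodule.dualAnnihilator
        (LinearMap.range (LieAlgebra.ad ℂ g e : g →ₗ[ℂ] g)),
      π (-(Φ f) + η) ∈ Oneg) := by

  intro π χbar coad Oneg
  have horth {a b : ℤ} (hab : a + b ≠ 0) {x y : g} (hx : x ∈ gr a) (hy : y ∈ gr b) :
      Φ x y = 0 := form_eq_zero_of_grading Φ hinv gr hdec hbr hab hx hy
  have hsub (y : nl) : nl.toSubmodule.subtype y = (y : g) := rfl
  have htop (z : g) : z ∈ ⨆ δ, gr δ := by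
    rw [hdec.submodule_iSup_eq_top]
    trivial
  let G : ℤ → Submodule ℂ g := fun c => ⨆ d : ℤ, ⨆ _ : c ≤ d, gr d
  have hgrG {c d : ℤ} (hcd : c ≤ d) : gr d ≤ G c := le_iSup₂_of_le d hcd le_rfl
  have hGanti {c c' : ℤ} (hc : c ≤ c') : G c' ≤ G c :=
    iSup₂_le fun d hd => hgrG (hc.trans hd)
  have hGbr (c c' d : ℤ) (hd : d ≤ c + c') {x y : g} (hx : x ∈ G c) (hy : y ∈ G c') :
      ⁅x, y⁆ ∈ G d := lie_mem_iSup_of_grading gr hbr hd hx hy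
  have hχ {x : g} (hx : x ∈ G 3) : Φ f x = 0 := by
    have h1 : G 3 ≤ LinearMap.ker (Φ f) :=
      iSup₂_le fun d hd x hx => horth (by omega) hf hx
    exact h1 hx
  have hlperpG : lperp ≤ G 1 := fun v hv => hgrG le_rfl ((hlperp v).mp hv).1
  have hnlG : nl.toSubmodule ≤ G 1 := by
    rw [hnl]
    exact sup_le hlperpG (hGanti (by norm_num))
  have hlperpnl : lperp ≤ nl.toSubmodule := hnl ▸ le_sup_left
  have hkkl : kk ≤ lperp := hkk_sup ▸ le_sup_left
  -- modulo `l` and `g_{≥2}`, an element of `nl` acts on `χ` as an element of `kk`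
  have hred {v : g} (hv : v ∈ nl.toSubmodule) :
      ∃ w ∈ kk, ∀ y ∈ nl.toSubmodule, Φ f ⁅v, y⁆ = Φ f ⁅w, y⁆ := by
    rw [hnl] at hv
    obtain ⟨v₁, hv₁, v₂, hv₂, rfl⟩ := Submodule.mem_sup.mp hv
    rw [← hkk_sup] at hv₁
    obtain ⟨w, hw, u, hu, rfl⟩ := Submodule.mem_sup.mp hv₁
    refine ⟨w, hw, fun y hy => ?_⟩
    have h2 : Φ f ⁅v₂, y⁆ = 0 := hχ (hGbr 2 1 3 (by norm_num) hv₂ (hnlG hy))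
    rw [hnl] at hy
    obtain ⟨y₁, hy₁, y₂, hy₂, rfl⟩ := Submodule.mem_sup.mp hy
    have h3 : Φ f ⁅u, y₁⁆ = 0 := by
      rw [← lie_skew, map_neg, ((hlperp y₁).mp hy₁).2 u hu, neg_zero]
    have h4 : Φ f ⁅u, y₂⁆ = 0 := hχ (hGbr 1 2 3 (by norm_num) (hgrG le_rfl (hl hu)) hy₂)
    rw [lie_add, map_add] at h2
    simp only [add_lie, lie_add, map_add, h3, h4]
    linear_combination h2
  have hexp (v : nl) : ∑ k ∈ Finset.range (K + 1),
      ((k.factorial : ℂ))⁻¹ • ((coad v ^ k) (-χbar)) = -χbar + coad v (-χbar) := by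
    refine sum_factorial_inv_smul_pow _ _ ?_ _ ?_
    · ext y
      have : Φ f ⁅(v : g), ⁅(v : g), (y : g)⁆⁆ = 0 :=
        hχ (hGbr 1 2 3 (by norm_num) (hnlG v.2)
          (hGbr 1 1 2 (by norm_num) (hnlG v.2) (hnlG y.2)))
      simp [coad, χbar, hsub, this]
    · rintro rfl
      ext y
      have h1 : ⁅v, y⁆ = 0 := by simpa using LinearMap.congr_fun (hK v) y
      have h2 : ⁅(v : g), (y : g)⁆ = 0 := by simpa using congrArg Subtype.val h1
      simp [coad, χbar, hsub, h2]
  have hmem (ξ : Module.Dual ℂ g) : π ξ ∈ Oneg ↔ ∃ v ∈ nl.toSubmodule, ∀ y ∈ nl.toSubmodule,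
      ξ y = -Φ f y + Φ f ⁅v, y⁆ := by
    constructor
    · rintro ⟨v, hv⟩
      refine ⟨v, v.2, fun y hy => ?_⟩
      rw [hexp] at hv
      simpa [π, coad, χbar, hsub] using LinearMap.congr_fun hv ⟨y, hy⟩
    · rintro ⟨v, hv, h⟩
      refine ⟨⟨v, hv⟩, ?_⟩
      rw [hexp]
      ext y
      simpa [π, coad, χbar, hsub] using h y y.2
  refine ⟨?_, ?_⟩
  · ext ξ
    refine (hmem ξ).trans ?_
    constructor
    · rintro ⟨v, hv, h⟩
      obtain ⟨w, hw, hvw⟩ := hred hv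
      refine ⟨-w, kk.neg_mem hw, ξ + Φ f + Φ f ∘ₗ LieAlgebra.ad ℂ g (-w), ?_, by abel⟩
      rw [Submodule.mem_dualAnnihilator]
      intro y hy
      simp [h y hy, hvw y hy]
    · rintro ⟨w, hw, η, hη, rfl⟩
      rw [Submodule.mem_dualAnnihilator] at hη
      refine ⟨-w, neg_mem (hlperpnl (hkkl hw)), fun y hy => ?_⟩
      have h1 : Φ f ⁅-w, y⁆ = -Φ f ⁅w, y⁆ := by rw [neg_lie, map_neg]
      rw [h1]
      simp only [LinearMap.add_apply, LinearMap.sub_apply, LinearMap.neg_apply,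
        LinearMap.comp_apply, LieAlgebra.ad_apply, hη y hy]
      ring
  · intro η hη
    rw [Submodule.mem_dualAnnihilator] at hη
    have hηe (x : g) : η ⁅e, x⁆ = 0 := hη _ ⟨x, rfl⟩
    have hsurj : Function.Surjective Φ := by
      refine (LinearMap.injective_iff_surjective_of_finrank_eq_finrank
        (Subspace.dual_finrank_eq).symm).mp ?_
      rw [injective_iff_map_eq_zero]
      exact fun x hx => hnondeg x fun y => by simp [hx]
    obtain ⟨a, rfl⟩ := hsurj η
    have hcomp (i : ℤ) : ∃ c ∈ gr i, ∀ w ∈ gr (-i), Φ c w = Φ a w := by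
      clear hη hηe
      induction htop a using Submodule.iSup_induction' with
      | zero => exact ⟨0, zero_mem _, by simp⟩
      | add a a' _ _ ih ih' =>
        obtain ⟨c, hc, h⟩ := ih
        obtain ⟨c', hc', h'⟩ := ih'
        exact ⟨c + c', add_mem hc hc', fun w hw => by simp [h w hw, h' w hw]⟩
      | mem j a ha =>
        by_cases hij : j = i
        · exact ⟨a, hij ▸ ha, fun _ _ => rfl⟩
        · exact ⟨0, zero_mem _, fun w hw => by simp [horth (by omega) ha hw]⟩
    have hgr (b : ℤ) (hb : 1 ≤ b) (y : g) (hy : y ∈ gr b) : Φ a y = 0 := by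
      obtain ⟨c, hc, hca⟩ := hcomp (-b)
      have hec : ⁅e, c⁆ = 0 := by
        refine hnondeg _ fun w => ?_
        induction htop w using Submodule.iSup_induction' with
        | zero => simp
        | add w w' _ _ ih ih' => simp [ih, ih']
        | mem j w hw =>
          by_cases hj : 2 + j = b
          · have hew : ⁅e, w⁆ ∈ gr (- -b) := by
              rw [neg_neg, ← hj]
              exact hbr 2 j e he w hw
            rw [← lie_skew, map_neg, LinearMap.neg_apply, hinv, hca _ hew, hηe, neg_zero]
          · exact horth (by omega) (hbr 2 (-b) e he c hc) hw
      obtain ⟨x, hx, rfl⟩ := hgoodsurj (2 - b) (by omega) c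
        (by rwa [show 2 - b - 2 = -b by ring])
      obtain ⟨N, hN⟩ := exists_ad_pow_eq_zero_of_grading gr hdec hbr (by norm_num) he hx
      obtain ⟨M, hM⟩ := exists_ad_pow_eq_zero_of_grading gr hdec hbr (by norm_num) hf hc
      have hc0 : ⁅f, x⁆ = 0 := by
        refine eq_zero_of_mem_ker_of_mem_range_sl2 (LieAlgebra.ad ℂ g e) (LieAlgebra.ad ℂ g h)
          (LieAlgebra.ad ℂ g f) ?_ ?_ ?_ M N x hec hN hM
        · ext z
          simp [leibniz_lie h e z, hsl2_he, add_comm, two_smul]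
        · ext z
          have h1 : ⁅h, ⁅f, z⁆⁆ = (-2 : ℤ) • ⁅f, z⁆ + ⁅f, ⁅h, z⁆⁆ := by
            rw [leibniz_lie, hsl2_hf, zsmul_lie]
          simp only [LinearMap.sub_apply, Module.End.mul_apply, LieAlgebra.ad_apply,
            LinearMap.smul_apply, h1]
          module
        · ext z
          simp [leibniz_lie e f z, hsl2_ef, add_comm]
      rw [← hca y (by rwa [neg_neg]), hc0]
      simp
    have hG1 : G 1 ≤ LinearMap.ker (Φ a) := iSup₂_le fun d hd y hy => hgr d hd y hy
    rw [hmem]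
    refine ⟨0, zero_mem _, fun y hy => ?_⟩
    simp [LinearMap.mem_ker.mp (hG1 (hnlG hy))]
end

section
/- Let g be simple with two commuting semisimple elements H₁, H₂ of a Cartan subalgebra giving good gradings for nilpotent elements f₁, f₂ respectively, satisfying the compatibility conditions (★): g^{(1)}_{≥2} ⊆ g^{(2)}_{≥1} ⊆ g^{(1)}_{≥0}, g^{(1)}_1 ⊆ g_{1,0} ⊕ g_{1,1} ⊕ g_{1,2}, g^{(2)}_1 ⊆ g_{0,1} ⊕ g_{1,1} ⊕ g_{2,1}, and f₀ := f₂ - f₁ ∈ g_{0,-2}. Then the symplectic forms ω₁(x,y) = (f₁|[x,y]) and ω₂(x,y) = (f₂|[x,y]) coincide on the bigraded component g_{1,1} = g^{(1)}_1 ∩ g^{(2)}_1, and g_{1,1} is a symplectic subspace of both (g^{(1)}_1, ω₁) and (g^{(2)}_1, ω₂). -/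
/-- The endomorphism of a `ℤ`-graded module acting on the component of degree `i` as the
scalar `i`. -/
theorem exists_linearMap_apply_eq_degree_smul {K V : Type*} [Field K] [AddCommGroup V] [Module K V]
    {gr : ℤ → Submodule K V} (hgr : DirectSum.IsInternal gr) :
    ∃ D : V →ₗ[K] V, ∀ i, ∀ x ∈ gr i, D x = (i : K) • x := by
  let e := LinearEquiv.ofBijective (DirectSum.coeLinearMap gr) hgr
  refine ⟨DirectSum.toModule K ℤ V (fun i ↦ (i : K) • (gr i).subtype) ∘ₗ e.symm.toLinearMap,
    fun i x hx ↦ ?_⟩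
  have he : e.symm x = DirectSum.lof K ℤ (fun i ↦ gr i) i ⟨x, hx⟩ := by
    rw [LinearEquiv.symm_apply_eq]
    exact (DirectSum.coeLinearMap_lof gr i ⟨x, hx⟩).symm
  simp [he]

/-- The degree map of a `ℤ`-graded Lie algebra is a derivation. -/
theorem exists_lieDerivation_apply_eq_degree_smul {K L : Type*} [Field K] [LieRing L]
    [LieAlgebra K L] {gr : ℤ → Submodule K L} (hgr : DirectSum.IsInternal gr)
    (hbr : ∀ i j : ℤ, ∀ x ∈ gr i, ∀ y ∈ gr j, ⁅x, y⁆ ∈ gr (i + j)) :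
    ∃ D : LieDerivation K L L, ∀ i, ∀ x ∈ gr i, D x = (i : K) • x := by
  obtain ⟨D, hD⟩ := exists_linearMap_apply_eq_degree_smul hgr
  have hmem (x : L) : x ∈ ⨆ i, gr i := hgr.submodule_iSup_eq_top ▸ Submodule.mem_top
  refine ⟨⟨D, fun x y ↦ ?_⟩, hD⟩
  induction hmem x using Submodule.iSup_induction' with
  | zero => simp
  | add x₁ x₂ _ _ h₁ h₂ => simp only [add_lie, lie_add, map_add, h₁, h₂]; abel
  | mem i x hx =>
    induction hmem y using Submodule.iSup_induction' with
    | zero => simp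
    | add y₁ y₂ _ _ h₁ h₂ => simp only [add_lie, lie_add, map_add, h₁, h₂]; abel
    | mem j y hy =>
      rw [hD _ _ (hbr i j x hx y hy), hD i x hx, hD j y hy, lie_smul, lie_smul, ← lie_skew x y,
        Int.cast_add, add_smul]
      module

/-- An invariant bilinear form on a `ℤ`-graded Lie algebra with nondegenerate Killing form
pairs nontrivially only components of opposite degrees. -/
theorem invariantForm_apply_eq_zero_of_add_ne_zero {K L : Type*} [Field K] [CharZero K]
    [LieRing L] [LieAlgebra K L] [FiniteDimensional K L] [LieAlgebra.IsKilling K L]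
    {Φ : L →ₗ[K] L →ₗ[K] K} (hinv : ∀ x y z : L, Φ ⁅x, y⁆ z = Φ x ⁅y, z⁆)
    {gr : ℤ → Submodule K L} (hgr : DirectSum.IsInternal gr)
    (hbr : ∀ i j : ℤ, ∀ x ∈ gr i, ∀ y ∈ gr j, ⁅x, y⁆ ∈ gr (i + j))
    {i j : ℤ} (hij : i + j ≠ 0) {x y : L} (hx : x ∈ gr i) (hy : y ∈ gr j) : Φ x y = 0 := by
  obtain ⟨D, hD⟩ := exists_lieDerivation_apply_eq_degree_smul hgr hbr
  obtain ⟨h, rfl⟩ := LieDerivation.IsKilling.exists_eq_ad D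
  simp only [LieDerivation.ad_apply_apply] at hD
  have key := hinv x h y
  rw [← lie_skew, hD i x hx, hD j y hy] at key
  simp only [map_neg, map_smul, LinearMap.neg_apply, LinearMap.smul_apply, smul_eq_mul] at key
  have : ((i + j : ℤ) : K) * Φ x y = 0 := by push_cast; linear_combination -key
  exact (mul_eq_zero.mp this).resolve_left (Int.cast_ne_zero.mpr hij)


/-- Under the compatibility conditions (★) for a pair of good gradings
`(f₁, H₁)`, `(f₂, H₂)` of a simple Lie algebra `g`, the symplectic forms
`ω₁(x,y) = (f₁|[x,y])` and `ω₂(x,y) = (f₂|[x,y])` coincide on the bigraded component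
`g_{1,1} = g^{(1)}₁ ∩ g^{(2)}₁`, and `g_{1,1}` is a symplectic subspace of both
`(g^{(1)}₁, ω₁)` and `(g^{(2)}₁, ω₂)`. -/
theorem statement7
    (g : Type*) [LieRing g] [LieAlgebra ℂ g] [FiniteDimensional ℂ g]
    [LieAlgebra.IsSimple ℂ g]
    (Φ : g →ₗ[ℂ] g →ₗ[ℂ] ℂ)
    (hsymm : ∀ x y : g, Φ x y = Φ y x)
    (hinv : ∀ x y z : g, Φ ⁅x, y⁆ z = Φ x ⁅y, z⁆)
    (hnondeg : ∀ x : g, (∀ y : g, Φ x y = 0) → x = 0)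
    (gr1 gr2 : ℤ → Submodule ℂ g)
    (hdec1 : DirectSum.IsInternal fun δ : ℤ => gr1 δ)
    (hdec2 : DirectSum.IsInternal fun δ : ℤ => gr2 δ)
    (hbidec : DirectSum.IsInternal fun p : ℤ × ℤ => gr1 p.1 ⊓ gr2 p.2)
    (hbr1 : ∀ δ₁ δ₂ : ℤ, ∀ x ∈ gr1 δ₁, ∀ y ∈ gr1 δ₂, ⁅x, y⁆ ∈ gr1 (δ₁ + δ₂))
    (hbr2 : ∀ δ₁ δ₂ : ℤ, ∀ x ∈ gr2 δ₁, ∀ y ∈ gr2 δ₂, ⁅x, y⁆ ∈ gr2 (δ₁ + δ₂))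
    (f1 f2 : g) (hf1 : f1 ∈ gr1 (-2)) (hf2 : f2 ∈ gr2 (-2))
    (hgood1inj : ∀ δ : ℤ, 1 ≤ δ → ∀ x ∈ gr1 δ, ⁅f1, x⁆ = 0 → x = 0)
    (hgood1surj : ∀ δ : ℤ, δ ≤ 1 → ∀ y ∈ gr1 (δ - 2), ∃ x ∈ gr1 δ, ⁅f1, x⁆ = y)
    (hgood2inj : ∀ δ : ℤ, 1 ≤ δ → ∀ x ∈ gr2 δ, ⁅f2, x⁆ = 0 → x = 0)
    (hgood2surj : ∀ δ : ℤ, δ ≤ 1 → ∀ y ∈ gr2 (δ - 2), ∃ x ∈ gr2 δ, ⁅f2, x⁆ = y)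
    (hstar1 : (⨆ d : ℤ, ⨆ _ : (2 : ℤ) ≤ d, gr1 d) ≤ ⨆ d : ℤ, ⨆ _ : (1 : ℤ) ≤ d, gr2 d)
    (hstar2 : (⨆ d : ℤ, ⨆ _ : (1 : ℤ) ≤ d, gr2 d) ≤ ⨆ d : ℤ, ⨆ _ : (0 : ℤ) ≤ d, gr1 d)
    (hstar3 : gr1 1 ≤ (gr1 1 ⊓ gr2 0) ⊔ (gr1 1 ⊓ gr2 1) ⊔ (gr1 1 ⊓ gr2 2))
    (hstar4 : gr2 1 ≤ (gr2 1 ⊓ gr1 0) ⊔ (gr2 1 ⊓ gr1 1) ⊔ (gr2 1 ⊓ gr1 2))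
    (hstar5 : f2 - f1 ∈ gr1 0 ⊓ gr2 (-2))
    :
    (∀ x ∈ gr1 1 ⊓ gr2 1, ∀ y ∈ gr1 1 ⊓ gr2 1, Φ f1 ⁅x, y⁆ = Φ f2 ⁅x, y⁆) ∧
    (∀ x ∈ gr1 1 ⊓ gr2 1, (∀ y ∈ gr1 1 ⊓ gr2 1, Φ f1 ⁅x, y⁆ = 0) → x = 0) ∧
    (∀ x ∈ gr1 1 ⊓ gr2 1, (∀ y ∈ gr1 1 ⊓ gr2 1, Φ f2 ⁅x, y⁆ = 0) → x = 0) := by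
  have orth1 {i j : ℤ} (hij : i + j ≠ 0) {x y : g} (hx : x ∈ gr1 i) (hy : y ∈ gr1 j) :
      Φ x y = 0 := invariantForm_apply_eq_zero_of_add_ne_zero hinv hdec1 hbr1 hij hx hy
  have orth2 {i j : ℤ} (hij : i + j ≠ 0) {x y : g} (hx : x ∈ gr2 i) (hy : y ∈ gr2 j) :
      Φ x y = 0 := invariantForm_apply_eq_zero_of_add_ne_zero hinv hdec2 hbr2 hij hx hy
  have heq : ∀ x ∈ gr1 1 ⊓ gr2 1, ∀ y ∈ gr1 1 ⊓ gr2 1, Φ f1 ⁅x, y⁆ = Φ f2 ⁅x, y⁆ := by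
    intro x hx y hy
    have h0 : Φ (f2 - f1) ⁅x, y⁆ = 0 :=
      orth1 (by norm_num) hstar5.1 (hbr1 1 1 x hx.1 y hy.1)
    rw [map_sub, LinearMap.sub_apply, sub_eq_zero] at h0
    exact h0.symm
  have hnd : ∀ x ∈ gr1 1 ⊓ gr2 1, (∀ y ∈ gr1 1 ⊓ gr2 1, Φ f1 ⁅x, y⁆ = 0) → x = 0 := by
    intro x hx h
    have hf12 : f1 ∈ gr2 (-2) := by simpa using sub_mem hf2 hstar5.2
    refine hgood1inj 1 le_rfl x hx.1 (hnondeg _ fun y ↦ ?_)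
    have hy : y ∈ ⨆ p : ℤ × ℤ, gr1 p.1 ⊓ gr2 p.2 :=
      hbidec.submodule_iSup_eq_top ▸ Submodule.mem_top
    induction hy using Submodule.iSup_induction' with
    | zero => simp
    | add y₁ y₂ _ _ h₁ h₂ => rw [map_add, h₁, h₂, add_zero]
    | mem p y hy =>
      obtain ⟨i, j⟩ := p
      by_cases hi : -2 + 1 + i = 0
      · by_cases hj : -2 + 1 + j = 0
        · obtain rfl : i = 1 := by lia
          obtain rfl : j = 1 := by lia
          rw [hinv]
          exact h y hy
        · exact orth2 hj (hbr2 _ _ f1 hf12 x hx.2) hy.2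
      · exact orth1 hi (hbr1 _ _ f1 hf1 x hx.1) hy.1
  exact ⟨heq, hnd, fun x hx h ↦ hnd x hx fun y hy ↦ (heq x hx y hy).trans (h y hy)⟩
end

section
/- Under the conditions (★), set n₀ := a ⊕ (g^{(1)}_0 ∩ g^{(2)}_{≥2}), n₁ := l₁^{⊥,ω₁} ⊕ g^{(1)}_{≥2}, n₂ := l₂^{⊥,ω₂} ⊕ g^{(2)}_{≥2}. Then: (1) n₁ is a Lie ideal of n₂; (2) n₀ is a Lie subalgebra of n₂ contained in g^{♮,1} := g^{(1)}_0 ∩ g^{f₁}, and n₂ = n₁ ⊕ n₀ as vector spaces. -/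
/-- In an independent family of submodules, sums over index sets intersect in the sum over the
intersection of the index sets. -/
theorem iSupIndep.biSup_inf_biSup_le {R M ι : Type*} [Ring R] [AddCommGroup M] [Module R M]
    {F : ι → Submodule R M} (hF : iSupIndep F) (S T : Set ι) :
    (⨆ p ∈ S, F p) ⊓ (⨆ p ∈ T, F p) ≤ ⨆ p ∈ S ∩ T, F p := by
  have hS : (⨆ p ∈ S, F p) = (⨆ p ∈ S ∩ T, F p) ⊔ ⨆ p ∈ S \ T, F p := by
    rw [← iSup_union, Set.inter_union_sdiff]
  have hle : (⨆ p ∈ S ∩ T, F p) ≤ ⨆ p ∈ T, F p := biSup_mono fun _ h => h.2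
  have hdisj : Disjoint (⨆ p ∈ S \ T, F p) (⨆ p ∈ T, F p) :=
    hF.disjoint_biSup_biSup Set.disjoint_sdiff_left
  rw [hS, sup_inf_assoc_of_le _ hle, hdisj.eq_bot, sup_bot_eq]

/-- A member of an independent family that lies below a sum of members with other indices is
zero. -/
theorem iSupIndep.eq_bot_of_le_biSup {R M ι : Type*} [Ring R] [AddCommGroup M] [Module R M]
    {F : ι → Submodule R M} (hF : iSupIndep F) {T : Set ι} {p : ι} (hp : p ∉ T)
    (h : F p ≤ ⨆ q ∈ T, F q) : F p = ⊥ :=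
  (hF.disjoint_biSup hp).eq_bot_of_le h

/-- If a family `B` spans the whole module and refines an independent family `A` along a map `π`
of index types, then each `A i` is the sum of the pieces refining it. -/
theorem iSupIndep.eq_biSup_of_refines {R M ι κ : Type*} [Ring R] [AddCommGroup M] [Module R M]
    {A : ι → Submodule R M} (hA : iSupIndep A) {B : κ → Submodule R M} (π : κ → ι)
    (hBA : ∀ k, B k ≤ A (π k)) (hB : iSup B = ⊤) (i : ι) :
    A i = ⨆ k ∈ {k | π k = i}, B k := by
  have hU : (⨆ k ∈ {k | π k = i}, B k) ≤ A i :=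
    iSup₂_le fun k hk => (hBA k).trans_eq (congrArg A hk)
  refine le_antisymm ?_ hU
  have htop : (⨆ k ∈ {k | π k = i}, B k) ⊔ (⨆ j, ⨆ _ : j ≠ i, A j) = ⊤ := by
    rw [eq_top_iff, ← hB]
    refine iSup_le fun k => ?_
    by_cases hk : π k = i
    · exact le_sup_of_le_left (le_iSup₂_of_le k hk le_rfl)
    · exact le_sup_of_le_right ((hBA k).trans (le_iSup₂_of_le (π k) hk le_rfl))
  have hmod := sup_inf_assoc_of_le (⨆ j, ⨆ _ : j ≠ i, A j) hU
  rw [htop, top_inf_eq, inf_comm, (hA i).eq_bot, sup_bot_eq] at hmod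
  exact hmod.le

/-- If brackets of pieces of a family land in `N`, so do brackets of sums of such pieces. -/
theorem lie_mem_of_mem_biSup {R L ι : Type*} [CommRing R] [LieRing L] [LieAlgebra R L]
    {F : ι → Submodule R L} {S T : Set ι} {N : Submodule R L}
    (h : ∀ p ∈ S, ∀ q ∈ T, ∀ x ∈ F p, ∀ y ∈ F q, ⁅x, y⁆ ∈ N) {x y : L}
    (hx : x ∈ ⨆ p ∈ S, F p) (hy : y ∈ ⨆ q ∈ T, F q) : ⁅x, y⁆ ∈ N := by
  have hpiece : ∀ q ∈ T, ∀ z ∈ F q, ⁅x, z⁆ ∈ N := by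
    intro q hq z hz
    have hle : (⨆ p ∈ S, F p) ≤ N.comap (LieAlgebra.ad R L z : L →ₗ[R] L) := by
      refine iSup₂_le fun p hp w hw => ?_
      have := N.neg_mem (h p hp q hq w hw z hz)
      rwa [lie_skew] at this
    have := N.neg_mem (hle hx)
    rwa [LieAlgebra.ad_apply, lie_skew] at this
  have hle : (⨆ q ∈ T, F q) ≤ N.comap (LieAlgebra.ad R L x : L →ₗ[R] L) :=
    iSup₂_le fun q hq z hz => hpiece q hq z hz
  exact hle hy

/-- The Killing form pairs homogeneous elements of a graded Lie algebra to zero unless their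
degrees are opposite. -/
theorem killingForm_eq_zero_of_add_ne_zero {K L : Type*} [Field K] [LieRing L] [LieAlgebra K L]
    [FiniteDimensional K L] {A : ℤ → Submodule K L} (hA : DirectSum.IsInternal A)
    (hbr : ∀ i j : ℤ, ∀ x ∈ A i, ∀ y ∈ A j, ⁅x, y⁆ ∈ A (i + j)) {i j : ℤ} (hij : i + j ≠ 0)
    {x y : L} (hx : x ∈ A i) (hy : y ∈ A j) : killingForm K L x y = 0 := by
  rw [killingForm_apply_apply]
  refine LinearMap.trace_eq_zero_of_mapsTo_ne hA (fun d => i + (j + d)) (fun d => by omega) ?_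
  intro d z hz
  exact hbr _ _ _ hx _ (hbr _ _ _ hy _ hz)

/-- For a Killing Lie algebra with two compatible gradings, the bigraded piece of bidegree
`(i, j)` vanishes as soon as the piece of bidegree `(-i, -j)` does. -/
theorem bigraded_eq_bot_of_neg_eq_bot {K L : Type*} [Field K] [LieRing L] [LieAlgebra K L]
    [FiniteDimensional K L] [LieAlgebra.IsKilling K L] {A B : ℤ → Submodule K L}
    (hA : DirectSum.IsInternal A) (hB : DirectSum.IsInternal B)
    (hAB : (⨆ p : ℤ × ℤ, A p.1 ⊓ B p.2) = ⊤)
    (hbrA : ∀ i j : ℤ, ∀ x ∈ A i, ∀ y ∈ A j, ⁅x, y⁆ ∈ A (i + j))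
    (hbrB : ∀ i j : ℤ, ∀ x ∈ B i, ∀ y ∈ B j, ⁅x, y⁆ ∈ B (i + j)) {i j : ℤ}
    (h : A (-i) ⊓ B (-j) = ⊥) : A i ⊓ B j = ⊥ := by
  refine (Submodule.eq_bot_iff _).2 fun x hx => ?_
  have hker : (⊤ : Submodule K L) ≤ LinearMap.ker (killingForm K L x) := by
    rw [← hAB]
    refine iSup_le fun p y hy => ?_
    by_cases h1 : i + p.1 = 0
    · by_cases h2 : j + p.2 = 0
      · have e1 : p.1 = -i := by omega
        have e2 : p.2 = -j := by omega
        rw [e1, e2, h, Submodule.mem_bot] at hy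
        simp [hy]
      · exact killingForm_eq_zero_of_add_ne_zero hB hbrB h2 hx.2 hy.2
    · exact killingForm_eq_zero_of_add_ne_zero hA hbrA h1 hx.1 hy.1
  have hx0 : x ∈ LinearMap.ker (killingForm K L) :=
    LinearMap.mem_ker.2 (LinearMap.ext fun y => hker Submodule.mem_top)
  rwa [LieAlgebra.IsKilling.ker_killingForm_eq_bot, Submodule.mem_bot] at hx0


/-- Under the conditions (★), with `a` chosen as in the previous
lemma, set `n₀ := a ⊕ (g^{(1)}₀ ∩ g^{(2)}_{≥2})`, `n₁ := l₁^{⊥,ω₁} ⊕ g^{(1)}_{≥2}`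
(where `l₁^{⊥,ω₁} = g_{1,1} ⊕ g_{1,2}`), and
`n₂ := l₂^{⊥,ω₂} ⊕ g^{(2)}_{≥2}` (where `l₂^{⊥,ω₂} = a ⊕ g_{1,1} ⊕ g_{2,1}`).  Then:
(1) `n₁` is a Lie ideal of `n₂`;
(2) `n₀` is a Lie subalgebra of `n₂` contained in `g^{♮,1} = g^{(1)}₀ ∩ g^{f₁}`, and
`n₂ = n₁ ⊕ n₀` as vector spaces. -/
theorem statement10
    (g : Type*) [LieRing g] [LieAlgebra ℂ g] [FiniteDimensional ℂ g]
    [LieAlgebra.IsSimple ℂ g]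
    (Φ : g →ₗ[ℂ] g →ₗ[ℂ] ℂ)
    (hsymm : ∀ x y : g, Φ x y = Φ y x)
    (hinv : ∀ x y z : g, Φ ⁅x, y⁆ z = Φ x ⁅y, z⁆)
    (hnondeg : ∀ x : g, (∀ y : g, Φ x y = 0) → x = 0)
    (gr1 gr2 : ℤ → Submodule ℂ g)
    (hdec1 : DirectSum.IsInternal fun δ : ℤ => gr1 δ)
    (hdec2 : DirectSum.IsInternal fun δ : ℤ => gr2 δ)
    (hbidec : DirectSum.IsInternal fun p : ℤ × ℤ => gr1 p.1 ⊓ gr2 p.2)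
    (hbr1 : ∀ δ₁ δ₂ : ℤ, ∀ x ∈ gr1 δ₁, ∀ y ∈ gr1 δ₂, ⁅x, y⁆ ∈ gr1 (δ₁ + δ₂))
    (hbr2 : ∀ δ₁ δ₂ : ℤ, ∀ x ∈ gr2 δ₁, ∀ y ∈ gr2 δ₂, ⁅x, y⁆ ∈ gr2 (δ₁ + δ₂))
    (f1 f2 : g) (hf1 : f1 ∈ gr1 (-2)) (hf2 : f2 ∈ gr2 (-2))
    (hgood1inj : ∀ δ : ℤ, 1 ≤ δ → ∀ x ∈ gr1 δ, ⁅f1, x⁆ = 0 → x = 0)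
    (hgood1surj : ∀ δ : ℤ, δ ≤ 1 → ∀ y ∈ gr1 (δ - 2), ∃ x ∈ gr1 δ, ⁅f1, x⁆ = y)
    (hgood2inj : ∀ δ : ℤ, 1 ≤ δ → ∀ x ∈ gr2 δ, ⁅f2, x⁆ = 0 → x = 0)
    (hgood2surj : ∀ δ : ℤ, δ ≤ 1 → ∀ y ∈ gr2 (δ - 2), ∃ x ∈ gr2 δ, ⁅f2, x⁆ = y)
    (hstar1 : (⨆ d : ℤ, ⨆ _ : (2 : ℤ) ≤ d, gr1 d) ≤ ⨆ d : ℤ, ⨆ _ : (1 : ℤ) ≤ d, gr2 d)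
    (hstar2 : (⨆ d : ℤ, ⨆ _ : (1 : ℤ) ≤ d, gr2 d) ≤ ⨆ d : ℤ, ⨆ _ : (0 : ℤ) ≤ d, gr1 d)
    (hstar3 : gr1 1 ≤ (gr1 1 ⊓ gr2 0) ⊔ (gr1 1 ⊓ gr2 1) ⊔ (gr1 1 ⊓ gr2 2))
    (hstar4 : gr2 1 ≤ (gr2 1 ⊓ gr1 0) ⊔ (gr2 1 ⊓ gr1 1) ⊔ (gr2 1 ⊓ gr1 2))
    (hstar5 : f2 - f1 ∈ gr1 0 ⊓ gr2 (-2))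
    (aa : Submodule ℂ g)
    (ha1 : aa ≤ (gr2 1 ⊓ gr1 0) ⊓ LinearMap.ker (LieAlgebra.ad ℂ g f1 : g →ₗ[ℂ] g))
    (ha2 : ∀ u ∈ aa ⊔ (gr2 1 ⊓ gr1 2), ∀ v ∈ aa ⊔ (gr2 1 ⊓ gr1 2), Φ f2 ⁅u, v⁆ = 0)
    (ha3 : {v : g | v ∈ gr2 1 ∧ ∀ u ∈ aa ⊔ (gr2 1 ⊓ gr1 2), Φ f2 ⁅v, u⁆ = 0}
        = ↑(aa ⊔ (gr2 1 ⊓ gr1 1) ⊔ (gr2 1 ⊓ gr1 2)))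
    (n0 n1 n2 : Submodule ℂ g)
    (hn0 : n0 = aa ⊔ (gr1 0 ⊓ (⨆ d : ℤ, ⨆ _ : (2 : ℤ) ≤ d, gr2 d)))
    (hn1 : n1 = ((gr1 1 ⊓ gr2 1) ⊔ (gr1 1 ⊓ gr2 2)) ⊔ (⨆ d : ℤ, ⨆ _ : (2 : ℤ) ≤ d, gr1 d))
    (hn2 : n2 = (aa ⊔ (gr1 1 ⊓ gr2 1) ⊔ (gr1 2 ⊓ gr2 1)) ⊔ (⨆ d : ℤ, ⨆ _ : (2 : ℤ) ≤ d, gr2 d))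
    :
    -- (1) n₁ is a Lie ideal of n₂
    n1 ≤ n2 ∧ (∀ x ∈ n2, ∀ y ∈ n1, ⁅x, y⁆ ∈ n1) ∧
    -- (2) n₀ is a subalgebra of n₂ contained in g^{♮,1}, and n₂ = n₁ ⊕ n₀
    n0 ≤ n2 ∧ (∀ x ∈ n0, ∀ y ∈ n0, ⁅x, y⁆ ∈ n0) ∧
    n0 ≤ gr1 0 ⊓ LinearMap.ker (LieAlgebra.ad ℂ g f1 : g →ₗ[ℂ] g) ∧
    n2 = n1 ⊔ n0 ∧ n1 ⊓ n0 = ⊥ := by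
  have hind1 := hdec1.submodule_iSupIndep
  have hind2 := hdec2.submodule_iSupIndep
  have hbi := hbidec.submodule_iSupIndep
  have htop := hbidec.submodule_iSup_eq_top
  set G : ℤ × ℤ → Submodule ℂ g := fun p => gr1 p.1 ⊓ gr2 p.2 with hG
  have hgr1 : ∀ i, gr1 i = ⨆ p ∈ {p : ℤ × ℤ | p.1 = i}, G p :=
    hind1.eq_biSup_of_refines Prod.fst (fun _ => inf_le_left) htop
  have hgr2 : ∀ j, gr2 j = ⨆ p ∈ {p : ℤ × ℤ | p.2 = j}, G p :=
    hind2.eq_biSup_of_refines Prod.snd (fun _ => inf_le_right) htop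
  have htail1 : ∀ k : ℤ, (⨆ d : ℤ, ⨆ _ : k ≤ d, gr1 d) = ⨆ p ∈ {p : ℤ × ℤ | k ≤ p.1}, G p := by
    intro k
    refine le_antisymm (iSup₂_le fun d hd => ?_) (iSup₂_le fun p hp => ?_)
    · rw [hgr1 d]
      exact biSup_mono fun p hp => hd.trans_eq (Eq.symm hp)
    · exact le_iSup₂_of_le p.1 hp inf_le_left
  have htail2 : ∀ k : ℤ, (⨆ d : ℤ, ⨆ _ : k ≤ d, gr2 d) = ⨆ p ∈ {p : ℤ × ℤ | k ≤ p.2}, G p := by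
    intro k
    refine le_antisymm (iSup₂_le fun d hd => ?_) (iSup₂_le fun p hp => ?_)
    · rw [hgr2 d]
      exact biSup_mono fun p hp => hd.trans_eq (Eq.symm hp)
    · exact le_iSup₂_of_le p.2 hp inf_le_right
  have hle : ∀ {S : Set (ℤ × ℤ)} {i j : ℤ}, (i, j) ∈ S → gr1 i ⊓ gr2 j ≤ ⨆ p ∈ S, G p :=
    fun {S i j} h => le_iSup₂_of_le (f := fun p (_ : p ∈ S) => G p) (i, j) h le_rfl
  -- vanishing of bigraded pieces
  have hz1 : ∀ i j : ℤ, 2 ≤ i → j < 1 → gr1 i ⊓ gr2 j = ⊥ := by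
    intro i j hi hj
    refine hbi.eq_bot_of_le_biSup (p := (i, j)) (T := {p | 1 ≤ p.2}) (by simpa using hj) ?_
    rw [htail1, htail2] at hstar1
    exact (hle (S := {p | 2 ≤ p.1}) hi).trans hstar1
  have hz2 : ∀ i j : ℤ, 1 ≤ j → i < 0 → gr1 i ⊓ gr2 j = ⊥ := by
    intro i j hj hi
    refine hbi.eq_bot_of_le_biSup (p := (i, j)) (T := {p | 0 ≤ p.1}) (by simpa using hi) ?_
    rw [htail1, htail2] at hstar2
    exact (hle (S := {p | 1 ≤ p.2}) hj).trans hstar2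
  have hz3 : ∀ j : ℤ, 2 < j → gr1 1 ⊓ gr2 j = ⊥ := by
    intro j hj
    refine hbi.eq_bot_of_le_biSup (p := (1, j)) (T := {p | p.2 ≤ 2}) (by simpa using hj) ?_
    refine inf_le_left.trans (hstar3.trans (sup_le (sup_le ?_ ?_) ?_)) <;>
      exact hle (by simp)
  have hz4 : ∀ i : ℤ, 2 < i → gr1 i ⊓ gr2 1 = ⊥ := by
    intro i hi
    refine hbi.eq_bot_of_le_biSup (p := (i, 1)) (T := {p | p.1 ≤ 2}) (by simpa using hi) ?_
    refine inf_le_right.trans (hstar4.trans (sup_le (sup_le ?_ ?_) ?_)) <;>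
      · rw [inf_comm]
        exact hle (by simp)
  have hz5 : gr1 (-2) ⊓ gr2 0 = ⊥ :=
    bigraded_eq_bot_of_neg_eq_bot hdec1 hdec2 htop hbr1 hbr2
      (by simpa using hz1 2 0 le_rfl one_pos)
  have hbrG : ∀ p q, ∀ x ∈ G p, ∀ y ∈ G q, ⁅x, y⁆ ∈ gr1 (p.1 + q.1) ⊓ gr2 (p.2 + q.2) :=
    fun p q x hx y hy => ⟨hbr1 _ _ _ hx.1 _ hy.1, hbr2 _ _ _ hx.2 _ hy.2⟩
  -- the three subspaces in terms of the bigraded pieces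
  have haa : aa ≤ gr1 0 ⊓ gr2 1 := fun x hx => ⟨(ha1 hx).1.2, (ha1 hx).1.1⟩
  have hzero : gr1 0 ⊓ (⨆ d : ℤ, ⨆ _ : (2 : ℤ) ≤ d, gr2 d) =
      ⨆ p ∈ {p : ℤ × ℤ | p.1 = 0 ∧ 2 ≤ p.2}, G p := by
    refine le_antisymm ?_ (le_inf ?_ ?_)
    · rw [htail2, hgr1]
      exact hbi.biSup_inf_biSup_le _ _
    · rw [hgr1]
      exact biSup_mono fun p hp => hp.1
    · rw [htail2]
      exact biSup_mono fun p hp => hp.2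
  rw [hzero] at hn0
  rw [htail1] at hn1
  rw [htail2] at hn2
  have hn1ge : ∀ i j : ℤ, 1 ≤ i → 2 ≤ j → gr1 i ⊓ gr2 j ≤ n1 := by
    intro i j hi hj
    rw [hn1]
    rcases hi.eq_or_lt with rfl | hi
    · rcases hj.eq_or_lt with rfl | hj
      · exact le_sup_of_le_left le_sup_right
      · exact (hz3 j hj).trans_le bot_le
    · exact le_sup_of_le_right (hle hi)
  have hn1le : n1 ≤ ⨆ p ∈ {p : ℤ × ℤ | 1 ≤ p.1 ∧ 1 ≤ p.2}, G p := by
    rw [hn1]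
    refine sup_le (sup_le (hle (by simp)) (hle (by simp))) (iSup₂_le fun p (hp : 2 ≤ p.1) => ?_)
    rcases lt_or_ge p.2 1 with h | h
    · exact (hz1 _ _ hp h).trans_le bot_le
    · exact hle ⟨by omega, h⟩
  have hn2le : n2 ≤ ⨆ p ∈ {p : ℤ × ℤ | 0 ≤ p.1 ∧ 1 ≤ p.2}, G p := by
    rw [hn2]
    refine sup_le (sup_le (sup_le (haa.trans (hle (by simp))) (hle (by simp))) (hle (by simp)))
      (iSup₂_le fun p (hp : 2 ≤ p.2) => ?_)
    rcases lt_or_ge p.1 0 with h | h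
    · exact (hz2 _ _ (by omega) h).trans_le bot_le
    · exact hle ⟨h, by omega⟩
  have hn0le : n0 ≤ ⨆ p ∈ {p : ℤ × ℤ | p.1 = 0 ∧ 1 ≤ p.2}, G p := by
    rw [hn0]
    exact sup_le (haa.trans (hle (by simp)))
      (biSup_mono fun p hp => ⟨hp.1, one_le_two.trans hp.2⟩)
  have hn12 : n1 ≤ n2 := by
    rw [hn1, hn2]
    refine sup_le (sup_le ?_ ?_) (iSup₂_le fun p (hp : 2 ≤ p.1) => ?_)
    · exact le_sup_of_le_left (le_sup_of_le_left le_sup_right)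
    · exact le_sup_of_le_right (hle (by simp))
    · rcases lt_trichotomy p.2 1 with h | h | h
      · exact (hz1 _ _ hp h).trans_le bot_le
      · rcases hp.eq_or_lt with h2 | h2
        · refine le_sup_of_le_left (le_sup_of_le_right ?_)
          simp only [hG, h, ← h2, le_refl]
        · simp only [hG, h]
          exact (hz4 _ h2).trans_le bot_le
      · exact le_sup_of_le_right (hle h)
  have hn02 : n0 ≤ n2 := by
    rw [hn0, hn2]
    exact sup_le (le_sup_of_le_left (le_sup_of_le_left le_sup_left))
      (le_sup_of_le_right (biSup_mono fun p hp => hp.2))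
  refine ⟨hn12, fun x hx y hy => ?_, hn02, fun x hx y hy => ?_, ?_, ?_, ?_⟩
  · refine lie_mem_of_mem_biSup ?_ (hn2le hx) (hn1le hy)
    rintro p ⟨hp1, hp2⟩ q ⟨hq1, hq2⟩ u hu v hv
    exact hn1ge _ _ (by omega) (by omega) (hbrG p q u hu v hv)
  · refine lie_mem_of_mem_biSup ?_ (hn0le hx) (hn0le hy)
    rintro p ⟨hp1, hp2⟩ q ⟨hq1, hq2⟩ u hu v hv
    rw [hn0]
    refine le_sup_of_le_right (hle ?_) (hbrG p q u hu v hv)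
    exact ⟨by omega, by omega⟩
  · rw [hn0]
    refine sup_le (fun x hx => ⟨(ha1 hx).1.2, (ha1 hx).2⟩) (iSup₂_le ?_)
    rintro ⟨i, j⟩ ⟨hi, hj⟩ x hx
    obtain rfl : i = 0 := hi
    have hf12 : f1 ∈ gr2 (-2) := by
      simpa using (gr2 (-2)).sub_mem hf2 hstar5.2
    refine ⟨hx.1, ?_⟩
    have hbr := hbrG (-2, -2) (0, j) f1 ⟨hf1, hf12⟩ x hx
    have hbot : gr1 (-2 + 0) ⊓ gr2 (-2 + j) = ⊥ := by
      rcases hj.eq_or_lt with h | h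
      · obtain rfl : 2 = j := h
        simpa using hz5
      · exact hz2 _ _ (by simp only at h; omega) (by norm_num)
    exact (Submodule.mem_bot ℂ).1 (hbot ▸ hbr)
  · refine le_antisymm ?_ (sup_le hn12 hn02)
    rw [hn2]
    refine sup_le (sup_le (sup_le ?_ ?_) ?_) (iSup₂_le fun p (hp : 2 ≤ p.2) => ?_)
    · exact le_sup_of_le_right (hn0 ▸ le_sup_left)
    · exact le_sup_of_le_left (hn1 ▸ le_sup_of_le_left le_sup_left)
    · exact le_sup_of_le_left (hn1 ▸ le_sup_of_le_right (hle (by simp)))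
    · rcases lt_trichotomy p.1 0 with h | h | h
      · exact (hz2 _ _ (by omega) h).trans_le bot_le
      · exact le_sup_of_le_right (hn0 ▸ le_sup_of_le_right (hle ⟨h, hp⟩))
      · exact le_sup_of_le_left (hn1ge _ _ h hp)
  · refine eq_bot_iff.2 ((inf_le_inf hn1le hn0le).trans ((hbi.biSup_inf_biSup_le _ _).trans ?_))
    refine iSup₂_le fun p hp => ?_
    have h1 := hp.1.1
    have h2 := hp.2.1
    omega
end

section
/- Under conditions (★), with ñ₂ = ñ₁ ⊕ n₀, Ñ₂ = Ñ₁ ⋊ N₀ the corresponding unipotent groups, and χ̃₂ the restriction of χ₂ = (f₂|·) to ñ₂: the restriction χ̄₀ of χ₂ to n₀ is a Lie algebra character (vanishes on [n₀,n₀]), the orbit Ad*(N₀)·χ̃₂ = {χ̃₂}, and hence the coadjoint orbit Õ₂ = Ad*(Ñ₂)·χ̃₂ equals Ad*(Ñ₁)·χ̃₂ = { Σ_{k=0}^{2} (1/k!) ad*(v)^k χ̃₂ : v ∈ ñ₁ }. -/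
/-- The sum of the components of degree at least `i` of a graded vector space. -/
def upperPart {g : Type*} [AddCommGroup g] [Module ℂ g] (gr : ℤ → Submodule ℂ g) (i : ℤ) :
    Submodule ℂ g :=
  ⨆ d : ℤ, ⨆ _ : i ≤ d, gr d

section Graded

variable {g : Type*} [AddCommGroup g] [Module ℂ g] {gr : ℤ → Submodule ℂ g}

lemma upperPart_le {i : ℤ} {S : Submodule ℂ g} (h : ∀ d, i ≤ d → gr d ≤ S) :
    upperPart gr i ≤ S :=
  iSup₂_le h

lemma mem_upperPart {i d : ℤ} (h : i ≤ d) {x : g} (hx : x ∈ gr d) : x ∈ upperPart gr i :=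
  (le_iSup₂_of_le (f := fun d (_ : i ≤ d) => gr d) d h le_rfl) hx

lemma upperPart_anti {i j : ℤ} (h : i ≤ j) : upperPart gr j ≤ upperPart gr i :=
  upperPart_le fun _ hd _ hx => mem_upperPart (h.trans hd) hx

lemma le_of_isInternal (hdec : DirectSum.IsInternal fun δ : ℤ => gr δ) {S : Submodule ℂ g}
    (h : ∀ d, gr d ≤ S) (x : g) : x ∈ S := by
  have htop := hdec.submodule_iSup_eq_top
  exact (iSup_le h) (htop ▸ Submodule.mem_top : x ∈ ⨆ d, gr d)

lemma exists_linearMap_of_family (hdec : DirectSum.IsInternal fun δ : ℤ => gr δ)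
    (T : ℤ → g →ₗ[ℂ] g) : ∃ S : g →ₗ[ℂ] g, ∀ i, ∀ x ∈ gr i, S x = T i x := by
  let e := LinearEquiv.ofBijective (DirectSum.coeLinearMap gr) hdec
  refine ⟨(DirectSum.toModule ℂ ℤ g fun i => T i ∘ₗ (gr i).subtype) ∘ₗ e.symm.toLinearMap,
    fun i x hx => ?_⟩
  have : e.symm x = DirectSum.lof ℂ ℤ (fun i => gr i) i ⟨x, hx⟩ := by
    rw [LinearEquiv.symm_apply_eq]
    exact (DirectSum.coeLinearMap_lof gr i ⟨x, hx⟩).symm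
  simp [this]

lemma exists_projections (hdec : DirectSum.IsInternal fun δ : ℤ => gr δ) :
    ∃ π : ℤ → g →ₗ[ℂ] g, (∀ i x, π i x ∈ gr i) ∧ (∀ i, ∀ x ∈ gr i, π i x = x) ∧
      ∀ i j, j ≠ i → ∀ x ∈ gr j, π i x = 0 := by
  have h (i : ℤ) := exists_linearMap_of_family hdec
    (fun j => if j = i then LinearMap.id else 0)
  choose π hπ using h
  refine ⟨π, fun i x => ?_, fun i x hx => by simp [hπ i i x hx],
    fun i j hj x hx => by simp [hπ i j x hx, hj]⟩
  refine le_of_isInternal hdec (S := (gr i).comap (π i)) (fun j x hx => ?_) x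
  rw [Submodule.mem_comap, hπ i j x hx]
  split_ifs with hj
  · simpa [← hj] using hx
  · simp

lemma eq_zero_of_mem_of_mem_upperPart (hdec : DirectSum.IsInternal fun δ : ℤ => gr δ)
    {i j : ℤ} (hij : i < j) {x : g} (hx : x ∈ gr i) (hx' : x ∈ upperPart gr j) : x = 0 := by
  obtain ⟨π, -, h1, h0⟩ := exists_projections hdec
  have : upperPart gr j ≤ LinearMap.ker (π i) :=
    upperPart_le fun d hd y hy => h0 i d (by omega) y hy
  rw [← h1 i x hx]
  exact this hx'

lemma sub_proj_mem_upperPart {π : ℤ → g →ₗ[ℂ] g}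
    (h1 : ∀ i, ∀ x ∈ gr i, π i x = x) (h0 : ∀ i j, j ≠ i → ∀ x ∈ gr j, π i x = 0)
    {i : ℤ} {x : g} (hx : x ∈ upperPart gr i) : x - π i x ∈ upperPart gr (i + 1) := by
  refine upperPart_le (S := (upperPart gr (i + 1)).comap (LinearMap.id - π i))
    (fun d hd y hy => ?_) hx
  rcases eq_or_ne d i with rfl | hne
  · simp [h1 d y hy]
  · simpa [h0 i d hne y hy] using mem_upperPart (by omega) hy

end Graded

section GradedLie

variable {g : Type*} [LieRing g] [LieAlgebra ℂ g] {gr : ℤ → Submodule ℂ g}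

lemma lie_mem_of_le {S T R : Submodule ℂ g} {ι κ : Type*} {s : ι → Submodule ℂ g}
    {t : κ → Submodule ℂ g} (hS : S ≤ ⨆ i, s i) (hT : T ≤ ⨆ i, t i)
    (h : ∀ i j, ∀ x ∈ s i, ∀ y ∈ t j, ⁅x, y⁆ ∈ R) {x y : g} (hx : x ∈ S) (hy : y ∈ T) :
    ⁅x, y⁆ ∈ R := by
  refine Submodule.iSup_induction s (motive := fun x => ⁅x, y⁆ ∈ R) (hS hx) (fun i x hx => ?_)
    (by simp) (fun a b ha hb => by rw [add_lie]; exact R.add_mem ha hb)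
  refine Submodule.iSup_induction t (motive := fun y => ⁅x, y⁆ ∈ R) (hT hy)
    (fun j y hy => h i j x hx y hy)
    (by simp) (fun a b ha hb => by rw [lie_add]; exact R.add_mem ha hb)

lemma lie_mem_upperPart
    (hbr : ∀ δ₁ δ₂ : ℤ, ∀ x ∈ gr δ₁, ∀ y ∈ gr δ₂, ⁅x, y⁆ ∈ gr (δ₁ + δ₂))
    {i j : ℤ} {x y : g} (hx : x ∈ upperPart gr i) (hy : y ∈ upperPart gr j) :
    ⁅x, y⁆ ∈ upperPart gr (i + j) := by
  have H (k : ℤ) : upperPart gr k ≤ ⨆ d : {d : ℤ // k ≤ d}, gr d :=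
    upperPart_le fun d hd => le_iSup (fun d : {d : ℤ // k ≤ d} => gr d) ⟨d, hd⟩
  exact lie_mem_of_le (H i) (H j) (fun a b x hx y hy =>
    mem_upperPart (add_le_add a.2 b.2) (hbr _ _ x hx y hy)) hx hy

lemma exists_eq_lie_of_leibniz [FiniteDimensional ℂ g] [LieAlgebra.IsSimple ℂ g]
    (hdec : DirectSum.IsInternal fun δ : ℤ => gr δ) (D : g →ₗ[ℂ] g)
    (hD : ∀ i j, ∀ x ∈ gr i, ∀ y ∈ gr j, D ⁅x, y⁆ = ⁅D x, y⁆ + ⁅x, D y⁆) :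
    ∃ a : g, ∀ x, D x = ⁅a, x⁆ := by
  have key (x y : g) : D ⁅x, y⁆ = ⁅D x, y⁆ + ⁅x, D y⁆ := by
    have htop := hdec.submodule_iSup_eq_top
    have hm (z : g) : z ∈ ⨆ d, gr d := htop ▸ Submodule.mem_top
    refine Submodule.iSup_induction _ (motive := fun x => D ⁅x, y⁆ = ⁅D x, y⁆ + ⁅x, D y⁆) (hm x)
      (fun i x hx => ?_) (by simp) (fun a b ha hb => ?_)
    · refine Submodule.iSup_induction _
        (motive := fun y => D ⁅x, y⁆ = ⁅D x, y⁆ + ⁅x, D y⁆) (hm y)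
        (fun j y hy => hD i j x hx y hy) (by simp) (fun a b ha hb => ?_)
      simp only [lie_add, map_add, ha, hb]
      abel
    · simp only [add_lie, map_add, ha, hb]
      abel
  let D' : LieDerivation ℂ g g :=
    { D with
      leibniz' := fun x y => by
        have := key x y
        rw [← lie_skew y (D x)]
        simpa [add_comm, sub_eq_add_neg] using this }
  obtain ⟨a, ha⟩ := LieDerivation.IsKilling.exists_eq_ad D'
  refine ⟨a, fun x => ?_⟩
  have := LieDerivation.congr_fun ha x
  simpa [D'] using this.symm

lemma exists_grading_element [FiniteDimensional ℂ g] [LieAlgebra.IsSimple ℂ g]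
    (hdec : DirectSum.IsInternal fun δ : ℤ => gr δ)
    (hbr : ∀ δ₁ δ₂ : ℤ, ∀ x ∈ gr δ₁, ∀ y ∈ gr δ₂, ⁅x, y⁆ ∈ gr (δ₁ + δ₂)) :
    ∃ h : g, ∀ i, ∀ x ∈ gr i, ⁅h, x⁆ = (i : ℂ) • x := by
  obtain ⟨D, hD⟩ := exists_linearMap_of_family hdec fun i => (i : ℂ) • LinearMap.id
  obtain ⟨a, ha⟩ := exists_eq_lie_of_leibniz hdec D fun i j x hx y hy => by
    rw [hD _ _ (hbr i j x hx y hy), hD i x hx, hD j y hy]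
    simp [add_smul]
  exact ⟨a, fun i x hx => by rw [← ha, hD i x hx]; simp⟩

lemma form_eq_zero_of_add_ne_zero [FiniteDimensional ℂ g] [LieAlgebra.IsSimple ℂ g]
    (hdec : DirectSum.IsInternal fun δ : ℤ => gr δ)
    (hbr : ∀ δ₁ δ₂ : ℤ, ∀ x ∈ gr δ₁, ∀ y ∈ gr δ₂, ⁅x, y⁆ ∈ gr (δ₁ + δ₂))
    {Φ : g →ₗ[ℂ] g →ₗ[ℂ] ℂ} (hinv : ∀ x y z : g, Φ ⁅x, y⁆ z = Φ x ⁅y, z⁆)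
    {i j : ℤ} (hij : i + j ≠ 0) {x y : g} (hx : x ∈ gr i) (hy : y ∈ gr j) : Φ x y = 0 := by
  obtain ⟨h, hh⟩ := exists_grading_element hdec hbr
  have e := hinv x h y
  rw [← lie_skew, hh i x hx, hh j y hy] at e
  simp only [map_neg, map_smul, LinearMap.neg_apply, LinearMap.smul_apply, smul_eq_mul] at e
  have : ((i + j : ℤ) : ℂ) * Φ x y = 0 := by
    push_cast
    linear_combination -e
  exact (mul_eq_zero.mp this).resolve_left (by exact_mod_cast hij)

lemma form_eq_zero_of_mem_upperPart [FiniteDimensional ℂ g] [LieAlgebra.IsSimple ℂ g]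
    (hdec : DirectSum.IsInternal fun δ : ℤ => gr δ)
    (hbr : ∀ δ₁ δ₂ : ℤ, ∀ x ∈ gr δ₁, ∀ y ∈ gr δ₂, ⁅x, y⁆ ∈ gr (δ₁ + δ₂))
    {Φ : g →ₗ[ℂ] g →ₗ[ℂ] ℂ} (hinv : ∀ x y z : g, Φ ⁅x, y⁆ z = Φ x ⁅y, z⁆)
    {i j : ℤ} (hij : 0 < i + j) {x y : g} (hx : x ∈ gr i) (hy : y ∈ upperPart gr j) :
    Φ x y = 0 := by
  refine upperPart_le (S := LinearMap.ker (Φ x)) (fun d hd y hy => ?_) hy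
  exact form_eq_zero_of_add_ne_zero hdec hbr hinv (by omega) hx hy

lemma exists_homogeneous_lie_approx [FiniteDimensional ℂ g] [LieAlgebra.IsSimple ℂ g]
    (hdec : DirectSum.IsInternal fun δ : ℤ => gr δ)
    (hbr : ∀ δ₁ δ₂ : ℤ, ∀ x ∈ gr δ₁, ∀ y ∈ gr δ₂, ⁅x, y⁆ ∈ gr (δ₁ + δ₂))
    (d : ℤ) (T : g →ₗ[ℂ] g) (hT : ∀ i, ∀ x ∈ gr i, T x ∈ upperPart gr (i + d))
    (hleib : ∀ i j, ∀ x ∈ gr i, ∀ y ∈ gr j,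
      T ⁅x, y⁆ - ⁅T x, y⁆ - ⁅x, T y⁆ ∈ upperPart gr (i + j + d + 1)) :
    ∃ u ∈ gr d, ∀ i, ∀ x ∈ gr i, T x - ⁅u, x⁆ ∈ upperPart gr (i + d + 1) := by
  obtain ⟨π, hπ, h1, h0⟩ := exists_projections hdec
  obtain ⟨D, hD⟩ := exists_linearMap_of_family hdec fun i => π (i + d) ∘ₗ T
  replace hD : ∀ i, ∀ x ∈ gr i, D x = π (i + d) (T x) := hD
  have hDgr (i : ℤ) (x : g) (hx : x ∈ gr i) : D x ∈ gr (i + d) := by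
    rw [hD i x hx]; exact hπ _ _
  have hTD (i : ℤ) (x : g) (hx : x ∈ gr i) : T x - D x ∈ upperPart gr (i + d + 1) := by
    rw [hD i x hx]; exact sub_proj_mem_upperPart h1 h0 (hT i x hx)
  obtain ⟨a, ha⟩ := exists_eq_lie_of_leibniz hdec D fun i j x hx y hy => by
    rw [← sub_eq_zero, ← sub_sub]
    refine eq_zero_of_mem_of_mem_upperPart hdec (lt_add_one (i + j + d)) ?_ ?_
    · refine sub_mem (sub_mem (hDgr _ _ (hbr i j x hx y hy)) ?_) ?_
      · convert hbr _ _ _ (hDgr i x hx) y hy using 2; ring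
      · convert hbr _ _ x hx _ (hDgr j y hy) using 2; ring
    · have e1 := hTD _ _ (hbr i j x hx y hy)
      have e2 := lie_mem_upperPart hbr (hTD i x hx) (mem_upperPart le_rfl hy)
      have e3 := lie_mem_upperPart hbr (mem_upperPart le_rfl hx) (hTD j y hy)
      rw [show i + d + 1 + j = i + j + d + 1 by ring] at e2
      rw [show i + (j + d + 1) = i + j + d + 1 by ring] at e3
      convert add_mem (add_mem (sub_mem (hleib i j x hx y hy) e1) e2) e3 using 1
      simp only [sub_lie, lie_sub]
      abel
  have hproj (k i : ℤ) (x : g) (hx : x ∈ gr i) (z : g) : π (k + i) ⁅z, x⁆ = ⁅π k z, x⁆ := by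
    have H := le_of_isInternal hdec (S := LinearMap.ker
      (π (k + i) ∘ₗ (LieAlgebra.ad ℂ g x : g →ₗ[ℂ] g) - (LieAlgebra.ad ℂ g x : g →ₗ[ℂ] g) ∘ₗ π k))
      (fun l z hz => ?_) z
    · rw [← lie_skew, ← lie_skew (π k z), map_neg, neg_inj]
      simpa [sub_eq_zero] using H
    · have hz' := hbr _ _ x hx z hz
      rcases eq_or_ne l k with rfl | hne
      · rw [add_comm] at hz'
        simp [h1 _ z hz, h1 _ _ hz']
      · simp [h0 _ _ hne z hz, h0 (k + i) (i + l) (by omega) _ hz']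
  refine ⟨π d a, hπ d a, fun i x hx => ?_⟩
  rw [← hproj d i x hx, ← ha, add_comm d i, h1 _ _ (hDgr i x hx)]
  exact hTD i x hx

lemma exists_quadratic_lie_approx [FiniteDimensional ℂ g] [LieAlgebra.IsSimple ℂ g]
    (hdec : DirectSum.IsInternal fun δ : ℤ => gr δ)
    (hbr : ∀ δ₁ δ₂ : ℤ, ∀ x ∈ gr δ₁, ∀ y ∈ gr δ₂, ⁅x, y⁆ ∈ gr (δ₁ + δ₂))
    (E : g →ₗ[ℂ] g) (hE : ∀ x y, E ⁅x, y⁆ = ⁅E x, E y⁆)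
    (hE1 : ∀ i, ∀ x ∈ upperPart gr i, E x - x ∈ upperPart gr (i + 1)) :
    ∃ u ∈ gr 1, ∃ b ∈ gr 2, ∀ i, ∀ x ∈ gr i,
      E x - (x + ⁅u, x⁆ + (2⁻¹ : ℂ) • ⁅u, ⁅u, x⁆⁆) - ⁅b, x⁆ ∈ upperPart gr (i + 3) := by
  have hgr {i : ℤ} {x : g} (hx : x ∈ gr i) : x ∈ upperPart gr i := mem_upperPart le_rfl hx
  have hlie {i j k : ℤ} (hk : k ≤ i + j) {x y : g} (hx : x ∈ upperPart gr i)
      (hy : y ∈ upperPart gr j) : ⁅x, y⁆ ∈ upperPart gr k :=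
    upperPart_anti hk (lie_mem_upperPart hbr hx hy)
  obtain ⟨u, hu, hEu⟩ := exists_homogeneous_lie_approx hdec hbr 1 (E - 1)
    (fun i x hx => hE1 i x (hgr hx)) fun i j x hx y hy => by
      have := hlie (k := i + j + 1 + 1) (by omega) (hE1 i x (hgr hx)) (hE1 j y (hgr hy))
      convert this using 1
      simp only [LinearMap.sub_apply, Module.End.one_apply, hE, sub_lie, lie_sub]
      abel
  let A : g →ₗ[ℂ] g := LieAlgebra.ad ℂ g u
  let P : g →ₗ[ℂ] g := 1 + A + (2⁻¹ : ℂ) • (A ∘ₗ A)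
  have hP (x : g) : P x = x + ⁅u, x⁆ + (2⁻¹ : ℂ) • ⁅u, ⁅u, x⁆⁆ := by simp [P, A]
  have hT (i : ℤ) (x : g) (hx : x ∈ gr i) : (E - P) x ∈ upperPart gr (i + 2) := by
    have e1 := hEu i x hx
    have e2 : ⁅u, ⁅u, x⁆⁆ ∈ upperPart gr (i + 2) :=
      hlie (by omega) (hgr hu) (hgr (hbr _ _ u hu x hx))
    rw [show i + 1 + 1 = i + 2 by ring] at e1
    convert sub_mem e1 (Submodule.smul_mem _ (2⁻¹ : ℂ) e2) using 1
    simp only [LinearMap.sub_apply, Module.End.one_apply, hP]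
    abel
  have hP1 (i : ℤ) (x : g) (hx : x ∈ gr i) : P x - x ∈ upperPart gr (i + 1) := by
    have e2 : ⁅u, ⁅u, x⁆⁆ ∈ upperPart gr (i + 1) :=
      hlie (i := 1) (j := i + 1) (by omega) (hgr hu) (hlie (by omega) (hgr hu) (hgr hx))
    have e1 : ⁅u, x⁆ ∈ upperPart gr (i + 1) := hlie (by omega) (hgr hu) (hgr hx)
    convert add_mem e1 (Submodule.smul_mem _ (2⁻¹ : ℂ) e2) using 1
    rw [hP]
    abel
  obtain ⟨b, hb, hEb⟩ := exists_homogeneous_lie_approx hdec hbr 2 (E - P) hT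
    fun i j x hx y hy => by
      have hux := hbr _ _ u hu x hx
      have huy := hbr _ _ u hu y hy
      have huux := hbr _ _ u hu _ hux
      have huuy := hbr _ _ u hu _ huy
      have t1 := hlie (k := i + j + 2 + 1) (by omega) (hP1 i x hx) (hT j y hy)
      have t2 := hlie (k := i + j + 2 + 1) (by omega) (hT i x hx) (hP1 j y hy)
      have t3 := hlie (k := i + j + 2 + 1) (by omega) (hT i x hx) (hT j y hy)
      have t4 := hlie (k := i + j + 2 + 1) (by omega) (hgr hux) (hgr huuy)
      have t5 := hlie (k := i + j + 2 + 1) (by omega) (hgr huux) (hgr huy)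
      have t6 := hlie (k := i + j + 2 + 1) (by omega) (hgr huux) (hgr huuy)
      have key : (E - P) ⁅x, y⁆ - ⁅(E - P) x, y⁆ - ⁅x, (E - P) y⁆ =
          ⁅P x - x, (E - P) y⁆ + ⁅(E - P) x, P y - y⁆ + ⁅(E - P) x, (E - P) y⁆
          + (2⁻¹ : ℂ) • ⁅⁅u, x⁆, ⁅u, ⁅u, y⁆⁆⁆ + (2⁻¹ : ℂ) • ⁅⁅u, ⁅u, x⁆⁆, ⁅u, y⁆⁆
          + (4⁻¹ : ℂ) • ⁅⁅u, ⁅u, x⁆⁆, ⁅u, ⁅u, y⁆⁆⁆ := by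
        have hPP : ⁅P x, P y⁆ = P ⁅x, y⁆
            + (2⁻¹ : ℂ) • ⁅⁅u, x⁆, ⁅u, ⁅u, y⁆⁆⁆ + (2⁻¹ : ℂ) • ⁅⁅u, ⁅u, x⁆⁆, ⁅u, y⁆⁆
            + (4⁻¹ : ℂ) • ⁅⁅u, ⁅u, x⁆⁆, ⁅u, ⁅u, y⁆⁆⁆ := by
          have a1 := leibniz_lie u x y
          have a2 : ⁅u, ⁅u, ⁅x, y⁆⁆⁆ = ⁅⁅u, ⁅u, x⁆⁆, y⁆ + ⁅⁅u, x⁆, ⁅u, y⁆⁆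
              + (⁅⁅u, x⁆, ⁅u, y⁆⁆ + ⁅x, ⁅u, ⁅u, y⁆⁆⁆) := by
            rw [a1, lie_add, leibniz_lie u ⁅u, x⁆ y, leibniz_lie u x ⁅u, y⁆]
          rw [hP, hP, hP, a2, a1]
          simp only [lie_add, add_lie, lie_smul, smul_lie]
          module
        have h1 : ⁅E x, E y⁆ - ⁅P x, P y⁆ =
            ⁅P x, (E - P) y⁆ + ⁅(E - P) x, P y⁆ + ⁅(E - P) x, (E - P) y⁆ := by
          simp only [LinearMap.sub_apply, sub_lie, lie_sub]
          abel
        have h2 : (E - P) ⁅x, y⁆ = ⁅E x, E y⁆ - P ⁅x, y⁆ := by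
          rw [LinearMap.sub_apply, hE]
        rw [h2, sub_lie, lie_sub, eq_add_of_sub_eq h1, hPP]
        abel
      rw [key]
      exact add_mem (add_mem (add_mem (add_mem (add_mem t1 t2) t3)
        (Submodule.smul_mem _ _ t4)) (Submodule.smul_mem _ _ t5)) (Submodule.smul_mem _ _ t6)
  refine ⟨u, hu, b, hb, fun i x hx => ?_⟩
  have := hEb i x hx
  rw [LinearMap.sub_apply, hP] at this
  simpa [add_assoc] using this

end GradedLie

section Exponential

variable {g : Type*} [LieRing g] [LieAlgebra ℂ g]

/-- The truncated exponential series of `ad v`, with `n` terms. -/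
noncomputable def expAd (n : ℕ) (v : g) : Module.End ℂ g :=
  ∑ k ∈ Finset.range n, ((k.factorial : ℂ))⁻¹ • (LieAlgebra.ad ℂ g v : Module.End ℂ g) ^ k

lemma expAd_apply (n : ℕ) (v w : g) : expAd n v w =
    ∑ k ∈ Finset.range n,
      ((k.factorial : ℂ))⁻¹ • ((LieAlgebra.ad ℂ g v : Module.End ℂ g) ^ k) w := by
  simp [expAd]

lemma expAd_map_lie_and_mul_neg {n : ℕ} {v : g}
    (hv : (LieAlgebra.ad ℂ g v : Module.End ℂ g) ^ n = 0) :
    (∀ x y, expAd n v ⁅x, y⁆ = ⁅expAd n v x, expAd n v y⁆) ∧ expAd n v * expAd n (-v) = 1 := by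
  let : Module ℚ g := Module.compHom g (algebraMap ℚ ℂ)
  have : IsScalarTower ℚ ℂ g := ⟨fun q c x => by
    change (q • c) • x = (algebraMap ℚ ℂ q) • c • x
    rw [Algebra.smul_def, mul_smul]⟩
  have hq (n : ℕ) (v : g) (hv : (LieAlgebra.ad ℂ g v : Module.End ℂ g) ^ n = 0) :
      expAd n v = IsNilpotent.exp (LieAlgebra.ad ℂ g v : Module.End ℂ g) := by
    rw [IsNilpotent.exp_eq_sum hv, expAd]
    refine Finset.sum_congr rfl fun k _ => ?_
    ext x
    have hc : ((k.factorial : ℂ))⁻¹ = algebraMap ℚ ℂ (k.factorial : ℚ)⁻¹ := by simp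
    rw [hc]
    rfl
  have hnil : IsNilpotent (LieAlgebra.ad ℂ g v : Module.End ℂ g) := ⟨n, hv⟩
  constructor
  · intro x y
    rw [hq n v hv]
    let _i := LieRing.toNonUnitalNonAssocRing g
    have : SMulCommClass ℂ g g := LieAlgebra.smulCommClass ℂ g
    have : IsScalarTower ℂ g g := LieAlgebra.isScalarTower ℂ g
    refine Module.End.exp_mul_of_derivation ℂ g (LieAlgebra.ad ℂ g v) (fun a b => ?_) hnil x y
    exact (leibniz_lie v a b).trans (add_comm _ _)
  · have hv' : (LieAlgebra.ad ℂ g (-v) : Module.End ℂ g) ^ n = 0 := by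
      rw [map_neg, neg_pow, hv, mul_zero]
    rw [hq n v hv, hq n (-v) hv', map_neg]
    exact IsNilpotent.exp_mul_exp_neg_self hnil

/-- For an endomorphism preserving the filtration, changing it by an endomorphism which raises
the filtration changes its powers by such endomorphisms. -/
lemma pow_sub_pow_mem_upperPart {gr : ℤ → Submodule ℂ g} {A B : Module.End ℂ g}
    (hA : ∀ i, ∀ x ∈ upperPart gr i, A x ∈ upperPart gr i)
    (hB : ∀ i, ∀ x ∈ upperPart gr i, B x ∈ upperPart gr i)
    (hAB : ∀ i, ∀ x ∈ upperPart gr i, A x - B x ∈ upperPart gr (i + 1)) (k : ℕ) (i : ℤ) (x : g)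
    (hx : x ∈ upperPart gr i) : (A ^ k) x - (B ^ k) x ∈ upperPart gr (i + 1) := by
  induction k generalizing x with
  | zero => simp
  | succ k ih =>
    have hBk : (B ^ k) (B x - A x) ∈ upperPart gr (i + 1) := by
      refine Module.End.pow_apply_mem_of_forall_mem k (fun y hy => hB _ y hy) _ ?_
      rw [← neg_sub]
      exact neg_mem (hAB i x hx)
    convert sub_mem (ih (A x) (hA i x hx)) hBk using 1
    simp [pow_succ]

lemma expAd_mem {S : Submodule ℂ g} {v : g} (hv : ∀ x ∈ S, ⁅v, x⁆ ∈ S) (n : ℕ) {x : g}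
    (hx : x ∈ S) : expAd n v x ∈ S := by
  rw [expAd_apply]
  exact Submodule.sum_smul_mem _ _ fun k _ =>
    Module.End.pow_apply_mem_of_forall_mem k (fun y hy => hv y hy) x hx

lemma expAd_mul_expAd_neg_sub_mem_upperPart {gr : ℤ → Submodule ℂ g}
    (hbr : ∀ δ₁ δ₂ : ℤ, ∀ x ∈ gr δ₁, ∀ y ∈ gr δ₂, ⁅x, y⁆ ∈ gr (δ₁ + δ₂))
    {n : ℕ} {v w : g} (hv : v ∈ gr 0) (hw : w ∈ upperPart gr 1)
    (hn : (LieAlgebra.ad ℂ g v : Module.End ℂ g) ^ n = 0) (i : ℤ) (x : g)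
    (hx : x ∈ upperPart gr i) :
    (expAd n v * expAd n (-(w + v))) x - x ∈ upperPart gr (i + 1) := by
  have hv' : v ∈ upperPart gr 0 := mem_upperPart le_rfl hv
  have hlie {z : g} (hz : z ∈ upperPart gr 0) (i : ℤ) (x : g) (hx : x ∈ upperPart gr i) :
      ⁅z, x⁆ ∈ upperPart gr i := by
    simpa using lie_mem_upperPart hbr hz hx
  have hvw : -(w + v) ∈ upperPart gr 0 := neg_mem (add_mem (upperPart_anti (by omega) hw) hv')
  have h1 : expAd n (-(w + v)) x - expAd n (-v) x ∈ upperPart gr (i + 1) := by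
    rw [expAd_apply, expAd_apply, ← Finset.sum_sub_distrib]
    simp_rw [← smul_sub]
    refine Submodule.sum_smul_mem _ _ fun k _ => ?_
    refine pow_sub_pow_mem_upperPart (hlie hvw) (hlie (neg_mem hv')) (fun i x hx => ?_) k i x hx
    rw [LieAlgebra.ad_apply, LieAlgebra.ad_apply, ← sub_lie,
      show -(w + v) - -v = -w by abel, add_comm i 1]
    exact lie_mem_upperPart hbr (neg_mem hw) hx
  have h2 := expAd_mem (hlie hv' (i + 1)) n h1
  have h3 := LinearMap.congr_fun (expAd_map_lie_and_mul_neg hn).2 x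
  rw [Module.End.mul_apply, Module.End.one_apply] at h3
  rwa [map_sub, h3] at h2

lemma sum_smul_comp_ad_pow_apply (χ : Module.Dual ℂ g) (n : ℕ) (v w : g) :
    (∑ k ∈ Finset.range n, ((-1 : ℂ) ^ k * ((k.factorial : ℂ))⁻¹) •
      (χ ∘ₗ ((LieAlgebra.ad ℂ g v : Module.End ℂ g) ^ k : g →ₗ[ℂ] g))) w
      = χ (expAd n (-v) w) := by
  rw [LinearMap.sum_apply, expAd_apply, map_sum]
  refine Finset.sum_congr rfl fun k _ => ?_
  have hneg : (LieAlgebra.ad ℂ g (-v) : Module.End ℂ g) ^ k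
      = (-1 : ℂ) ^ k • (LieAlgebra.ad ℂ g v : Module.End ℂ g) ^ k := by
    rw [map_neg, ← neg_one_smul ℂ (LieAlgebra.ad ℂ g v : Module.End ℂ g), smul_pow]
  rw [hneg]
  simp only [LinearMap.smul_apply, LinearMap.comp_apply, map_smul, smul_eq_mul]
  ring

end Exponential


set_option maxHeartbeats 400000 in
/-- Under the conditions (★), with `ñ₂ = ñ₁ ⊕ n₀`,
`Ñ₂ = Ñ₁ ⋊ N₀` the corresponding unipotent groups, and `χ̃₂` the restriction of
`χ₂ = (f₂|·)` to `ñ₂`: the restriction `χ̄₀` of `χ₂` to `n₀` is a Lie algebra character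
(it vanishes on `[n₀, n₀]`), the coadjoint orbit `Ad*(N₀)·χ̃₂` is `{χ̃₂}`, and the
coadjoint orbit `Õ₂ = Ad*(Ñ₂)·χ̃₂` equals
`Ad*(Ñ₁)·χ̃₂ = {Σ_{k=0}^{2} (1/k!) ad*(v)^k χ̃₂ : v ∈ ñ₁}`.
Orbits of the unipotent groups are realized through exponentials: for `v ∈ ñ₂`,
`Ad*(exp v)χ̃₂` is the restriction to `ñ₂` of `Σ_k ((-1)^k/k!) χ₂ ∘ (ad v)^k`. -/
theorem statement12
    (g : Type*) [LieRing g] [LieAlgebra ℂ g] [FiniteDimensional ℂ g]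
    [LieAlgebra.IsSimple ℂ g]
    (Φ : g →ₗ[ℂ] g →ₗ[ℂ] ℂ)
    (hsymm : ∀ x y : g, Φ x y = Φ y x)
    (hinv : ∀ x y z : g, Φ ⁅x, y⁆ z = Φ x ⁅y, z⁆)
    (hnondeg : ∀ x : g, (∀ y : g, Φ x y = 0) → x = 0)
    (gr1 gr2 : ℤ → Submodule ℂ g)
    (hdec1 : DirectSum.IsInternal fun δ : ℤ => gr1 δ)
    (hdec2 : DirectSum.IsInternal fun δ : ℤ => gr2 δ)
    (hbidec : DirectSum.IsInternal fun p : ℤ × ℤ => gr1 p.1 ⊓ gr2 p.2)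
    (hbr1 : ∀ δ₁ δ₂ : ℤ, ∀ x ∈ gr1 δ₁, ∀ y ∈ gr1 δ₂, ⁅x, y⁆ ∈ gr1 (δ₁ + δ₂))
    (hbr2 : ∀ δ₁ δ₂ : ℤ, ∀ x ∈ gr2 δ₁, ∀ y ∈ gr2 δ₂, ⁅x, y⁆ ∈ gr2 (δ₁ + δ₂))
    (f1 f2 : g) (hf1 : f1 ∈ gr1 (-2)) (hf2 : f2 ∈ gr2 (-2))
    (hgood1inj : ∀ δ : ℤ, 1 ≤ δ → ∀ x ∈ gr1 δ, ⁅f1, x⁆ = 0 → x = 0)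
    (hgood1surj : ∀ δ : ℤ, δ ≤ 1 → ∀ y ∈ gr1 (δ - 2), ∃ x ∈ gr1 δ, ⁅f1, x⁆ = y)
    (hgood2inj : ∀ δ : ℤ, 1 ≤ δ → ∀ x ∈ gr2 δ, ⁅f2, x⁆ = 0 → x = 0)
    (hgood2surj : ∀ δ : ℤ, δ ≤ 1 → ∀ y ∈ gr2 (δ - 2), ∃ x ∈ gr2 δ, ⁅f2, x⁆ = y)
    (hstar1 : (⨆ d : ℤ, ⨆ _ : (2 : ℤ) ≤ d, gr1 d) ≤ ⨆ d : ℤ, ⨆ _ : (1 : ℤ) ≤ d, gr2 d)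
    (hstar2 : (⨆ d : ℤ, ⨆ _ : (1 : ℤ) ≤ d, gr2 d) ≤ ⨆ d : ℤ, ⨆ _ : (0 : ℤ) ≤ d, gr1 d)
    (hstar3 : gr1 1 ≤ (gr1 1 ⊓ gr2 0) ⊔ (gr1 1 ⊓ gr2 1) ⊔ (gr1 1 ⊓ gr2 2))
    (hstar4 : gr2 1 ≤ (gr2 1 ⊓ gr1 0) ⊔ (gr2 1 ⊓ gr1 1) ⊔ (gr2 1 ⊓ gr1 2))
    (hstar5 : f2 - f1 ∈ gr1 0 ⊓ gr2 (-2))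
    (aa : Submodule ℂ g)
    (ha1 : aa ≤ (gr2 1 ⊓ gr1 0) ⊓ LinearMap.ker (LieAlgebra.ad ℂ g f1 : g →ₗ[ℂ] g))
    (ha2 : ∀ u ∈ aa ⊔ (gr2 1 ⊓ gr1 2), ∀ v ∈ aa ⊔ (gr2 1 ⊓ gr1 2), Φ f2 ⁅u, v⁆ = 0)
    (ha3 : {v : g | v ∈ gr2 1 ∧ ∀ u ∈ aa ⊔ (gr2 1 ⊓ gr1 2), Φ f2 ⁅v, u⁆ = 0}
        = ↑(aa ⊔ (gr2 1 ⊓ gr1 1) ⊔ (gr2 1 ⊓ gr1 2)))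
    (n0 n1 n2 : Submodule ℂ g)
    (hn0 : n0 = aa ⊔ (gr1 0 ⊓ (⨆ d : ℤ, ⨆ _ : (2 : ℤ) ≤ d, gr2 d)))
    (hn1 : n1 = ((gr1 1 ⊓ gr2 1) ⊔ (gr1 1 ⊓ gr2 2)) ⊔ (⨆ d : ℤ, ⨆ _ : (2 : ℤ) ≤ d, gr1 d))
    (hn2 : n2 = (aa ⊔ (gr1 1 ⊓ gr2 1) ⊔ (gr1 2 ⊓ gr2 1)) ⊔ (⨆ d : ℤ, ⨆ _ : (2 : ℤ) ≤ d, gr2 d))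
    (nt1 nt2 : Submodule ℂ g)
    (hnt1 : nt1 = ⨆ d : ℤ, ⨆ _ : (1 : ℤ) ≤ d, gr1 d)
    (hnt2 : nt2 = nt1 ⊔ n0)
    (K : ℕ) (hK : ∀ v ∈ nt2, (LieAlgebra.ad ℂ g v : Module.End ℂ g) ^ (K + 1) = 0) :
    -- `F v` is `Ad*(exp v)χ₂` as a functional on `g`, `G v` its degree-≤2 truncation
    let F : g → Module.Dual ℂ g := fun v =>
      ∑ k ∈ Finset.range (K + 1), ((-1 : ℂ) ^ k * ((k.factorial : ℂ))⁻¹) •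
        ((Φ f2) ∘ₗ ((LieAlgebra.ad ℂ g v : Module.End ℂ g) ^ k : g →ₗ[ℂ] g))
    let G : g → Module.Dual ℂ g := fun v =>
      ∑ k ∈ Finset.range 3, ((-1 : ℂ) ^ k * ((k.factorial : ℂ))⁻¹) •
        ((Φ f2) ∘ₗ ((LieAlgebra.ad ℂ g v : Module.End ℂ g) ^ k : g →ₗ[ℂ] g))
    -- restriction of functionals to `ñ₂`
    let r : Module.Dual ℂ g →ₗ[ℂ] Module.Dual ℂ nt2 := LinearMap.dualMap nt2.subtype
    -- `χ̄₀` is a character of `n₀`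
    (∀ x ∈ n0, ∀ y ∈ n0, Φ f2 ⁅x, y⁆ = 0) ∧
    -- `Ad*(N₀)·χ̃₂ = {χ̃₂}`
    (∀ v ∈ n0, r (F v) = r (Φ f2)) ∧
    -- `Õ₂ = Ad*(Ñ₂)·χ̃₂ = Ad*(Ñ₁)·χ̃₂`
    ({ξ : Module.Dual ℂ nt2 | ∃ v ∈ nt2, ξ = r (F v)}
      = {ξ : Module.Dual ℂ nt2 | ∃ v ∈ nt1, ξ = r (F v)}) ∧
    -- `Ad*(Ñ₁)·χ̃₂ = {Σ_{k=0}^{2} (1/k!) ad*(v)^k χ̃₂ : v ∈ ñ₁}`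
    ({ξ : Module.Dual ℂ nt2 | ∃ v ∈ nt1, ξ = r (F v)}
      = {ξ : Module.Dual ℂ nt2 | ∃ v ∈ nt1, ξ = r (G v)}) := by
  intro F G r
  set f0 : g := f2 - f1 with hf0
  have hf2eq : f2 = f1 + f0 := by rw [hf0]; abel
  have hf0gr1 : f0 ∈ gr1 0 := hstar5.1
  have hf1gr2 : f1 ∈ gr2 (-2) := by
    have := sub_mem hf2 hstar5.2
    rwa [hf2eq, add_sub_cancel_right] at this
  have hn0' : n0 = aa ⊔ (gr1 0 ⊓ upperPart gr2 2) := hn0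
  have hnt1' : nt1 = upperPart gr1 1 := hnt1
  have hΦ (x y : g) : Φ f2 ⁅x, y⁆ = Φ f1 ⁅x, y⁆ + Φ f0 ⁅x, y⁆ := by
    rw [hf2eq, map_add, LinearMap.add_apply]
  have hn0gr1 : n0 ≤ gr1 0 := hn0' ▸ sup_le (fun x hx => (ha1 hx).1.2) inf_le_left
  have hn0gr2 : n0 ≤ upperPart gr2 1 := hn0' ▸ sup_le
    (fun x hx => mem_upperPart le_rfl (ha1 hx).1.1)
    (inf_le_right.trans (upperPart_anti (by omega)))
  have hf1n0 : ∀ x ∈ n0, ⁅f1, x⁆ = 0 := by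
    have : n0 ≤ LinearMap.ker (LieAlgebra.ad ℂ g f1 : g →ₗ[ℂ] g) := by
      rw [hn0']
      refine sup_le (fun x hx => (ha1 hx).2) fun x hx => ?_
      refine hnondeg _ fun y => le_of_isInternal hdec1 (S := LinearMap.ker (Φ ⁅f1, x⁆))
        (fun d y hy => ?_) y
      have h1 : ⁅f1, x⁆ ∈ gr1 (-2) := by simpa using hbr1 _ _ f1 hf1 x hx.1
      rcases eq_or_ne d 2 with rfl | hd
      · have h2 := lie_mem_upperPart hbr2 hx.2
          (hstar1 (mem_upperPart le_rfl hy) : y ∈ upperPart gr2 1)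
        rw [LinearMap.mem_ker, hinv]
        exact form_eq_zero_of_mem_upperPart hdec2 hbr2 hinv (by norm_num) hf1gr2 h2
      · exact form_eq_zero_of_add_ne_zero hdec1 hbr1 hinv (by omega) h1 hy
    exact fun x hx => this hx
  have hchar : ∀ x ∈ n0, ∀ y ∈ n0, Φ f2 ⁅x, y⁆ = 0 := by
    intro x hx y hy
    have hx' := hn0gr2 hx
    have hy' := hn0gr2 hy
    rw [hn0'] at hx hy
    obtain ⟨a, ha, s, hs, rfl⟩ := Submodule.mem_sup.mp hx
    obtain ⟨a', ha', s', hs', rfl⟩ := Submodule.mem_sup.mp hy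
    have ha0 : a ∈ upperPart gr2 1 := mem_upperPart le_rfl (ha1 ha).1.1
    rw [add_lie, lie_add a, map_add, map_add,
      ha2 a (Submodule.mem_sup_left ha) a' (Submodule.mem_sup_left ha'),
      form_eq_zero_of_mem_upperPart hdec2 hbr2 hinv (by norm_num) hf2
        (lie_mem_upperPart hbr2 ha0 hs'.2),
      form_eq_zero_of_mem_upperPart hdec2 hbr2 hinv (by norm_num) hf2
        (lie_mem_upperPart hbr2 hs.2 hy')]
    simp
  have hn0nt2 : n0 ≤ nt2 := hnt2 ▸ le_sup_right
  have hnt1nt2 : nt1 ≤ nt2 := hnt2 ▸ le_sup_left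
  have hnt2up : nt2 ≤ upperPart gr1 0 := by
    rw [hnt2, hnt1']
    exact sup_le (upperPart_anti (by omega)) fun x hx => mem_upperPart le_rfl (hn0gr1 hx)
  have hn0act (v : g) (hv : v ∈ n0) (w : g) (hw : w ∈ nt2) : ⁅v, w⁆ ∈ nt2 ∧ Φ f2 ⁅v, w⁆ = 0 := by
    rw [hnt2] at hw
    obtain ⟨x, hx, y, hy, rfl⟩ := Submodule.mem_sup.mp hw
    rw [hnt1'] at hx
    have hvx : ⁅v, x⁆ ∈ upperPart gr1 1 := by
      simpa using lie_mem_upperPart hbr1 (mem_upperPart le_rfl (hn0gr1 hv)) hx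
    have hvy : ⁅v, y⁆ ∈ n0 := by
      rw [hn0']
      refine Submodule.mem_sup_right ⟨?_, ?_⟩
      · simpa using hbr1 _ _ v (hn0gr1 hv) y (hn0gr1 hy)
      · exact upperPart_anti (by norm_num) (lie_mem_upperPart hbr2 (hn0gr2 hv) (hn0gr2 hy))
    rw [lie_add]
    refine ⟨add_mem (hnt1nt2 (hnt1' ▸ hvx)) (hn0nt2 hvy), ?_⟩
    rw [map_add, hchar v hv y hy, hΦ, ← hinv, hf1n0 v hv,
      form_eq_zero_of_mem_upperPart hdec1 hbr1 hinv (by norm_num) hf0gr1 hvx]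
    simp
  have hexpn0 (v : g) (hv : v ∈ n0) (w : g) (hw : w ∈ nt2) (n : ℕ) :
      Φ f2 (expAd (n + 1) (-v) w) = Φ f2 w := by
    have hv' := neg_mem hv
    rw [expAd_apply, Finset.sum_range_succ', map_add, map_sum, Finset.sum_eq_zero]
    · simp
    · intro k _
      rw [map_smul, pow_succ', Module.End.mul_apply, LieAlgebra.ad_apply,
        (hn0act (-v) hv' _ (Module.End.pow_apply_mem_of_forall_mem k
          (fun y hy => (hn0act (-v) hv' y hy).1) w hw)).2, smul_zero]
  have hF (v w : g) : F v w = Φ f2 (expAd (K + 1) (-v) w) := sum_smul_comp_ad_pow_apply _ _ _ _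
  have hG (v w : g) : G v w = Φ f2 (expAd 3 (-v) w) := sum_smul_comp_ad_pow_apply _ _ _ _
  have hr (ξ η : Module.Dual ℂ g) : r ξ = r η ↔ ∀ w ∈ nt2, ξ w = η w := by
    rw [LinearMap.ext_iff]
    exact ⟨fun h w hw => h ⟨w, hw⟩, fun h w => h w w.2⟩
  have hkill (z : g) (hz : z ∈ upperPart gr1 3) : Φ f2 z = 0 := by
    rw [hf2eq, map_add, LinearMap.add_apply,
      form_eq_zero_of_mem_upperPart hdec1 hbr1 hinv (by norm_num) hf1 hz,
      form_eq_zero_of_mem_upperPart hdec1 hbr1 hinv (by norm_num) hf0gr1 hz, add_zero]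
  have htrunc (v : g) (hv : v ∈ nt1) (w : g) (hw : w ∈ nt2) :
      Φ f2 (expAd (K + 1) v w) = Φ f2 (expAd 3 v w) := by
    have hpow (k : ℕ) : ((LieAlgebra.ad ℂ g v : Module.End ℂ g) ^ k) w ∈ upperPart gr1 k := by
      induction k with
      | zero => simpa using hnt2up hw
      | succ k ih =>
        rw [pow_succ', Module.End.mul_apply, LieAlgebra.ad_apply, Nat.cast_succ, add_comm]
        exact lie_mem_upperPart hbr1 (hnt1' ▸ hv) ih
    have hext (n : ℕ) (hn : n ≤ K + 4) (hz : ∀ k, n ≤ k →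
        Φ f2 (((LieAlgebra.ad ℂ g v : Module.End ℂ g) ^ k) w) = 0) :
        Φ f2 (expAd n v w) = Φ f2 (expAd (K + 4) v w) := by
      rw [expAd_apply, expAd_apply, map_sum, map_sum]
      refine Finset.sum_subset (Finset.range_mono hn) fun k _ hk => ?_
      rw [map_smul, hz k (by simpa using hk), smul_zero]
    rw [hext (K + 1) (by omega) fun k hk => by
        rw [pow_eq_zero_of_le hk (hK v (hnt1nt2 hv)), LinearMap.zero_apply, map_zero],
      hext 3 (by omega) fun k hk => hkill _ (upperPart_anti (by exact_mod_cast hk) (hpow k))]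
  refine ⟨hchar, fun v hv => ?_, Set.Subset.antisymm ?_ ?_, ?_⟩
  · exact (hr _ _).2 fun w hw => by rw [hF, hexpn0 v hv w hw]
  · rintro ξ ⟨v, hv, rfl⟩
    rw [hnt2] at hv
    obtain ⟨w₁, hw₁, v₀, hv₀, rfl⟩ := Submodule.mem_sup.mp hv
    have hK₀ := hK v₀ (hn0nt2 hv₀)
    have hKneg := hK _ (neg_mem (hnt2 ▸ hv : w₁ + v₀ ∈ nt2))
    set E : Module.End ℂ g := expAd (K + 1) v₀ * expAd (K + 1) (-(w₁ + v₀)) with hEdef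
    have hE1 := expAd_mul_expAd_neg_sub_mem_upperPart hbr1 (hn0gr1 hv₀) (hnt1' ▸ hw₁) hK₀
    have hElie (x y : g) : E ⁅x, y⁆ = ⁅E x, E y⁆ := by
      simp only [hEdef, Module.End.mul_apply, (expAd_map_lie_and_mul_neg hKneg).1,
        (expAd_map_lie_and_mul_neg hK₀).1]
    obtain ⟨u, hu, b, hb, hub⟩ := exists_quadratic_lie_approx hdec1 hbr1 E hElie hE1
    have hu1 : u ∈ nt1 := hnt1' ▸ mem_upperPart le_rfl hu
    refine ⟨-u, neg_mem hu1, (hr _ _).2 fun w hw => ?_⟩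
    have hEw : E w ∈ nt2 := by
      have h : E w - w ∈ nt2 := hnt1nt2 (hnt1' ▸ hE1 0 w (hnt2up hw))
      simpa only [sub_add_cancel] using add_mem h hw
    have hinvE : expAd (K + 1) (-v₀) (E w) = expAd (K + 1) (-(w₁ + v₀)) w := by
      have h := (expAd_map_lie_and_mul_neg (hK _ (neg_mem (hn0nt2 hv₀)))).2
      rw [neg_neg] at h
      rw [hEdef, ← Module.End.mul_apply, ← mul_assoc, h, one_mul]
    rw [hF, hF, neg_neg, ← hinvE, hexpn0 v₀ hv₀ _ hEw, htrunc u hu1 w hw, ← sub_eq_zero, ← map_sub]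
    have happrox (d : ℤ) (hd : 0 ≤ d) (x : g) (hx : x ∈ gr1 d) :
        Φ f2 ((E - expAd 3 u) x) = Φ f2 ⁅b, x⁆ := by
      have h := hkill _ (upperPart_anti (by omega) (hub d x hx))
      rw [map_sub, sub_eq_zero] at h
      rw [← h, LinearMap.sub_apply, expAd_apply]
      simp [Finset.sum_range_succ, pow_two]
    have hker : nt2 ≤ LinearMap.ker (Φ f2 ∘ₗ (E - expAd 3 u)) := by
      rw [hnt2, hnt1']
      refine sup_le (upperPart_le fun d hd x hx => ?_) fun x hx => ?_
      · rw [LinearMap.mem_ker, LinearMap.comp_apply, happrox d (by omega) x hx]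
        exact hkill _ (mem_upperPart (by omega) (hbr1 _ _ b hb x hx))
      · rw [LinearMap.mem_ker, LinearMap.comp_apply, happrox 0 le_rfl x (hn0gr1 hx), hΦ,
          form_eq_zero_of_add_ne_zero hdec1 hbr1 hinv (by norm_num) hf0gr1
            (hbr1 _ _ b hb x (hn0gr1 hx)),
          ← lie_skew, map_neg, ← hinv, hf1n0 x hx]
        simp
    exact hker hw
  · rintro ξ ⟨v, hv, rfl⟩
    exact ⟨v, hnt1nt2 hv, rfl⟩
  · have hFG (v : g) (hv : v ∈ nt1) : r (F v) = r (G v) :=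
      (hr _ _).2 fun w hw => by rw [hF, hG, htrunc _ (neg_mem hv) w hw]
    ext ξ
    exact exists_congr fun v => and_congr_right fun hv => by rw [hFG v hv]
end

section
/- Under conditions (★), the map σ̃₂ : g^{(1)}_1 → ñ₂*, v ↦ χ̃₂ + ad*(v)χ̃₂ + (1/2) ad*(v)² χ̃₂, is a bijection onto the coadjoint orbit Õ₂ = Ad*(Ñ₂)·χ̃₂, and the restriction map ñ₂* → ñ₁* maps Õ₂ bijectively onto Õ₁ = Ad*(Ñ₁)·χ̃₁, intertwining σ̃₂ with σ̃₁ : v ↦ χ̃₁ + ad*(v)χ̃₁. -/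
/-- The derivation of a `ℤ`-graded Lie algebra which acts on the degree `i` part as `i`. -/
theorem exists_degree_lieDerivation {g : Type*} [LieRing g] [LieAlgebra ℂ g]
    (gr : ℤ → Submodule ℂ g) (hdec : DirectSum.IsInternal fun i : ℤ => gr i)
    (hbr : ∀ i j : ℤ, ∀ x ∈ gr i, ∀ y ∈ gr j, ⁅x, y⁆ ∈ gr (i + j)) :
    ∃ D : LieDerivation ℂ g g, ∀ i : ℤ, ∀ x ∈ gr i, D x = (i : ℂ) • x := by
  obtain ⟨T, hT⟩ : ∃ T : g →ₗ[ℂ] g, ∀ i : ℤ, ∀ x ∈ gr i, T x = (i : ℂ) • x := by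
    let e := LinearEquiv.ofBijective (DirectSum.coeLinearMap gr) hdec
    refine ⟨(DirectSum.toModule ℂ ℤ g fun i => (i : ℂ) • (gr i).subtype) ∘ₗ e.symm.toLinearMap,
      fun i x hx => ?_⟩
    have he : e.symm x = DirectSum.lof ℂ ℤ (fun i => gr i) i ⟨x, hx⟩ := by
      rw [LinearEquiv.symm_apply_eq]
      exact (DirectSum.coeLinearMap_lof gr i ⟨x, hx⟩).symm
    simp [he]
  have htop := hdec.submodule_iSup_eq_top
  refine ⟨⟨T, fun a b => ?_⟩, hT⟩
  have ha : a ∈ ⨆ i, gr i := htop ▸ Submodule.mem_top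
  have hb : b ∈ ⨆ i, gr i := htop ▸ Submodule.mem_top
  induction ha using Submodule.iSup_induction' with
  | zero => simp
  | add x y _ _ hx hy => simp only [add_lie, lie_add, map_add, hx, hy]; abel
  | mem i x hx =>
    induction hb using Submodule.iSup_induction' with
    | zero => simp
    | add y z _ _ hy hz => simp only [add_lie, lie_add, map_add, hy, hz]; abel
    | mem j y hy =>
      rw [hT _ _ (hbr i j x hx y hy), hT i x hx, hT j y hy, lie_smul, lie_smul,
        ← lie_skew x y]
      push_cast
      module

/-- An invariant form on a simple Lie algebra pairs the degree `i` and `j` parts of a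
`ℤ`-grading trivially unless `i + j = 0`. -/
theorem invariantForm_eq_zero_of_add_ne_zero {g : Type*} [LieRing g] [LieAlgebra ℂ g]
    [FiniteDimensional ℂ g] [LieAlgebra.IsSimple ℂ g] (Φ : g →ₗ[ℂ] g →ₗ[ℂ] ℂ)
    (hinv : ∀ x y z : g, Φ ⁅x, y⁆ z = Φ x ⁅y, z⁆)
    (gr : ℤ → Submodule ℂ g) (hdec : DirectSum.IsInternal fun i : ℤ => gr i)
    (hbr : ∀ i j : ℤ, ∀ x ∈ gr i, ∀ y ∈ gr j, ⁅x, y⁆ ∈ gr (i + j))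
    {i j : ℤ} (hij : i + j ≠ 0) {x y : g} (hx : x ∈ gr i) (hy : y ∈ gr j) : Φ x y = 0 := by
  obtain ⟨D, hD⟩ := exists_degree_lieDerivation gr hdec hbr
  obtain ⟨h, rfl⟩ := LieDerivation.IsKilling.exists_eq_ad D
  have h1 := hD i x hx
  have h2 := hD j y hy
  rw [LieDerivation.ad_apply_apply] at h1 h2
  have h3 := hinv x h y
  rw [← lie_skew, h1, h2] at h3
  simp only [map_neg, map_smul, LinearMap.neg_apply, LinearMap.smul_apply, smul_eq_mul] at h3
  have h4 : ((i + j : ℤ) : ℂ) * Φ x y = 0 := by push_cast; linear_combination -h3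
  exact (mul_eq_zero.mp h4).resolve_left (by exact_mod_cast hij)

/-- The part of degree at least `m` of a `ℤ`-graded module. -/
def degreeGE {g : Type*} [AddCommGroup g] [Module ℂ g] (gr : ℤ → Submodule ℂ g) (m : ℤ) :
    Submodule ℂ g :=
  ⨆ d : ℤ, ⨆ _ : m ≤ d, gr d

theorem le_degreeGE {g : Type*} [AddCommGroup g] [Module ℂ g] (gr : ℤ → Submodule ℂ g)
    {m d : ℤ} (h : m ≤ d) : gr d ≤ degreeGE gr m :=
  le_iSup₂_of_le d h le_rfl

theorem degreeGE_le {g : Type*} [AddCommGroup g] [Module ℂ g] {gr : ℤ → Submodule ℂ g}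
    {m : ℤ} {S : Submodule ℂ g} (h : ∀ d, m ≤ d → gr d ≤ S) : degreeGE gr m ≤ S :=
  iSup₂_le h

theorem degreeGE_anti {g : Type*} [AddCommGroup g] [Module ℂ g] (gr : ℤ → Submodule ℂ g)
    {m n : ℤ} (h : m ≤ n) : degreeGE gr n ≤ degreeGE gr m :=
  degreeGE_le fun _ hd => le_degreeGE gr (h.trans hd)

theorem degreeGE_le_sup {g : Type*} [AddCommGroup g] [Module ℂ g] (gr : ℤ → Submodule ℂ g)
    (m : ℤ) : degreeGE gr m ≤ gr m ⊔ degreeGE gr (m + 1) :=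
  degreeGE_le fun d hd => by
    rcases hd.eq_or_lt with rfl | hd
    · exact le_sup_left
    · exact (le_degreeGE gr (by lia)).trans le_sup_right

theorem lie_mem_degreeGE_add {g : Type*} [LieRing g] [LieAlgebra ℂ g] {gr : ℤ → Submodule ℂ g}
    (hbr : ∀ i j : ℤ, ∀ x ∈ gr i, ∀ y ∈ gr j, ⁅x, y⁆ ∈ gr (i + j))
    {m n : ℤ} {x y : g} (hx : x ∈ degreeGE gr m) (hy : y ∈ degreeGE gr n) :
    ⁅x, y⁆ ∈ degreeGE gr (m + n) := by
  have h1 : ∀ i, m ≤ i → ∀ a ∈ gr i, ⁅a, y⁆ ∈ degreeGE gr (m + n) := fun i hi a ha => by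
    have : degreeGE gr n ≤
        (degreeGE gr (m + n)).comap (LieAlgebra.ad ℂ g a : Module.End ℂ g) :=
      degreeGE_le fun j hj b hb => le_degreeGE gr (add_le_add hi hj) (hbr i j a ha b hb)
    exact this hy
  have h2 : degreeGE gr m ≤
      (degreeGE gr (m + n)).comap (LieAlgebra.ad ℂ g y : Module.End ℂ g) :=
    degreeGE_le fun i hi a ha => by
      rw [Submodule.mem_comap, LieAlgebra.ad_apply, ← lie_skew]
      exact neg_mem (h1 i hi a ha)
  have h3 : ⁅y, x⁆ ∈ degreeGE gr (m + n) := h2 hx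
  rw [← lie_skew]
  exact neg_mem h3

theorem lie_mem_degreeGE {g : Type*} [LieRing g] [LieAlgebra ℂ g] {gr : ℤ → Submodule ℂ g}
    (hbr : ∀ i j : ℤ, ∀ x ∈ gr i, ∀ y ∈ gr j, ⁅x, y⁆ ∈ gr (i + j))
    {k m n : ℤ} (h : k ≤ m + n) {x y : g} (hx : x ∈ degreeGE gr m) (hy : y ∈ degreeGE gr n) :
    ⁅x, y⁆ ∈ degreeGE gr k :=
  degreeGE_anti gr h (lie_mem_degreeGE_add hbr hx hy)

theorem ad_pow_mem_degreeGE {g : Type*} [LieRing g] [LieAlgebra ℂ g] {gr : ℤ → Submodule ℂ g}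
    (hbr : ∀ i j : ℤ, ∀ x ∈ gr i, ∀ y ∈ gr j, ⁅x, y⁆ ∈ gr (i + j))
    {n : ℤ} {v x : g} (hv : v ∈ degreeGE gr 1) (hx : x ∈ degreeGE gr n) (k : ℕ) :
    ((LieAlgebra.ad ℂ g v : Module.End ℂ g) ^ k) x ∈ degreeGE gr (n + k) := by
  induction k with
  | zero => simpa using hx
  | succ k ih =>
    rw [pow_succ', Module.End.mul_apply, LieAlgebra.ad_apply]
    exact lie_mem_degreeGE hbr (by push_cast; linarith) hv ih

/-- A form that pairs opposite degrees only pairs degree `i` trivially with degrees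
greater than `-i`. -/
theorem form_eq_zero_of_mem_degreeGE {g : Type*} [AddCommGroup g] [Module ℂ g]
    {Φ : g →ₗ[ℂ] g →ₗ[ℂ] ℂ} {gr : ℤ → Submodule ℂ g}
    (hΦ : ∀ i j : ℤ, i + j ≠ 0 → ∀ x ∈ gr i, ∀ y ∈ gr j, Φ x y = 0)
    {i m : ℤ} (h : 0 < i + m) {f x : g} (hf : f ∈ gr i) (hx : x ∈ degreeGE gr m) :
    Φ f x = 0 := by
  have : degreeGE gr m ≤ LinearMap.ker (Φ f) :=
    degreeGE_le fun d hd y hy => hΦ i d (by lia) f hf y hy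
  exact this hx

theorem hasDerivAt_bilin_sum {ι V : Type*} [AddCommGroup V] [Module ℂ V]
    (B : V →ₗ[ℂ] V →ₗ[ℂ] ℂ) (s : Finset ι) (e : ι → V) (c c' : ι → ℂ → ℂ) (t : ℂ)
    (hc : ∀ i ∈ s, HasDerivAt (c i) (c' i t) t) :
    HasDerivAt (fun z => B (∑ i ∈ s, c i z • e i) (∑ i ∈ s, c i z • e i))
      (B (∑ i ∈ s, c' i t • e i) (∑ i ∈ s, c i t • e i)
        + B (∑ i ∈ s, c i t • e i) (∑ i ∈ s, c' i t • e i)) t := by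
  simp only [map_sum, LinearMap.sum_apply, map_smul, LinearMap.smul_apply, smul_eq_mul,
    Finset.mul_sum, ← Finset.sum_add_distrib]
  refine HasDerivAt.fun_sum fun j hj => ?_
  refine HasDerivAt.fun_sum fun i hi => ?_
  refine (((hc j hj).mul ((hc i hi).mul_const (B (e i) (e j))))).congr_deriv ?_
  ring

theorem hasDerivAt_linear_sum {ι V : Type*} [AddCommGroup V] [Module ℂ V]
    (b : V →ₗ[ℂ] ℂ) (s : Finset ι) (e : ι → V) (c c' : ι → ℂ → ℂ) (t : ℂ)
    (hc : ∀ i ∈ s, HasDerivAt (c i) (c' i t) t) :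
    HasDerivAt (fun z => b (∑ i ∈ s, c i z • e i)) (b (∑ i ∈ s, c' i t • e i)) t := by
  simp only [map_sum, map_smul, smul_eq_mul]
  exact HasDerivAt.fun_sum fun i hi => (hc i hi).mul_const _

theorem hasDerivAt_pow_succ_div_factorial (k : ℕ) (t : ℂ) :
    HasDerivAt (fun z : ℂ => z ^ (k + 1) * ((k + 1).factorial : ℂ)⁻¹)
      (t ^ k * (k.factorial : ℂ)⁻¹) t := by
  refine ((hasDerivAt_pow (k + 1) t).mul_const ((k + 1).factorial : ℂ)⁻¹).congr_deriv ?_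
  have h1 : (k.factorial : ℂ) ≠ 0 := by exact_mod_cast k.factorial_ne_zero
  have h2 : (k : ℂ) + 1 ≠ 0 := by exact_mod_cast k.succ_ne_zero
  rw [Nat.factorial_succ]
  push_cast
  field_simp

/-- Uniqueness for the linear equation `∂ₜ φ(t, x) = -φ(t, N x)` with `N` nilpotent. -/
theorem eq_exp_sum_of_hasDerivAt {V : Type*} [AddCommGroup V] [Module ℂ V]
    (N : Module.End ℂ V) (P : Submodule ℂ V) (hNP : ∀ x ∈ P, N x ∈ P) (φ : ℂ → V → ℂ)
    (hφ : ∀ t, ∀ x ∈ P, HasDerivAt (fun z => φ z x) (-φ t (N x)) t)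
    (hzero : ∀ t, φ t 0 = 0) (n : ℕ) :
    ∀ x ∈ P, (N ^ n) x = 0 → ∀ t, φ t x =
      ∑ k ∈ Finset.range n, (-1) ^ k * (t ^ k * (k.factorial : ℂ)⁻¹) * φ 0 ((N ^ k) x) := by
  induction n with
  | zero =>
    intro x _ hx t
    have : x = 0 := by simpa using hx
    simp [this, hzero]
  | succ n ih =>
    intro x hxP hx t
    have hN := ih (N x) (hNP x hxP) (by rwa [← Module.End.mul_apply, ← pow_succ])
    set ψ : ℂ → ℂ := fun z => ∑ k ∈ Finset.range (n + 1),
      (-1) ^ k * (z ^ k * (k.factorial : ℂ)⁻¹) * φ 0 ((N ^ k) x) with hψ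
    have hd : ∀ z, HasDerivAt ψ (-φ z (N x)) z := fun z => by
      rw [hN z, hψ]
      simp only [Finset.sum_range_succ']
      rw [← Finset.sum_neg_distrib]
      simp only [pow_zero]
      refine HasDerivAt.congr_deriv (HasDerivAt.add_const _ (HasDerivAt.fun_sum fun k _ =>
        ((hasDerivAt_pow_succ_div_factorial k z).const_mul _).mul_const _)) ?_
      refine Finset.sum_congr rfl fun k _ => ?_
      rw [pow_succ N, Module.End.mul_apply]
      ring
    have hsub : ∀ z, HasDerivAt (fun z => φ z x - ψ z) 0 z := fun z => by
      exact ((hφ z x hxP).sub (hd z)).congr_deriv (sub_self _)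
    have hconst := is_const_of_deriv_eq_zero (fun z => (hsub z).differentiableAt)
      (fun z => (hsub z).deriv) t 0
    have h0 : ψ 0 = φ 0 x := by
      simp [hψ, Finset.sum_range_succ']
    simp only [h0, sub_self] at hconst
    exact sub_eq_zero.mp hconst

/-- If the affine vector field `u ↦ v₁ + [v₀, u]` on `U` intertwines, through the quadratic map
`u ↦ χ - χ∘ad u + ½ χ∘(ad u)²`, with the coadjoint vector field of `v` on functionals on `P`,
then `χ∘exp(-ad v)` lies in the image of `U` under that map. -/
theorem exists_quadratic_eq_exp {g : Type*} [LieRing g] [LieAlgebra ℂ g]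
    (χ : g →ₗ[ℂ] ℂ) (P U : Submodule ℂ g) (v v0 v1 : g) (K : ℕ)
    (hv : (LieAlgebra.ad ℂ g v : Module.End ℂ g) ^ (K + 1) = 0)
    (hv0 : (LieAlgebra.ad ℂ g v0 : Module.End ℂ g) ^ (K + 1) = 0)
    (hP : ∀ x ∈ P, ⁅v, x⁆ ∈ P) (hU : ∀ u ∈ U, ⁅v0, u⁆ ∈ U) (hv1 : v1 ∈ U)
    (hode : ∀ u ∈ U, ∀ x ∈ P,
      -χ ⁅v1 + ⁅v0, u⁆, x⁆
          + 2⁻¹ * (χ ⁅v1 + ⁅v0, u⁆, ⁅u, x⁆⁆ + χ ⁅u, ⁅v1 + ⁅v0, u⁆, x⁆⁆)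
        = -(χ ⁅v, x⁆ - χ ⁅u, ⁅v, x⁆⁆ + 2⁻¹ * χ ⁅u, ⁅u, ⁅v, x⁆⁆⁆)) :
    ∃ u ∈ U, ∀ x ∈ P, χ x - χ ⁅u, x⁆ + 2⁻¹ * χ ⁅u, ⁅u, x⁆⁆
      = ∑ k ∈ Finset.range (K + 1), ((-1 : ℂ) ^ k * ((k.factorial : ℂ))⁻¹) *
          χ (((LieAlgebra.ad ℂ g v : Module.End ℂ g) ^ k) x) := by
  set D : Module.End ℂ g := LieAlgebra.ad ℂ g v0 with hD
  set N : Module.End ℂ g := LieAlgebra.ad ℂ g v with hN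
  have hDU : ∀ k : ℕ, (D ^ k) v1 ∈ U := fun k => by
    induction k with
    | zero => simpa using hv1
    | succ k ih => rw [pow_succ', Module.End.mul_apply]; exact hU _ ih
  let u : ℂ → g := fun t => ∑ k ∈ Finset.range (K + 1),
    (t ^ (k + 1) * ((k + 1).factorial : ℂ)⁻¹) • (D ^ k) v1
  have huU : ∀ t, u t ∈ U := fun t => Submodule.sum_mem _ fun k _ => U.smul_mem _ (hDU k)
  have hu' : ∀ t, ∑ k ∈ Finset.range (K + 1), (t ^ k * (k.factorial : ℂ)⁻¹) • (D ^ k) v1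
      = v1 + ⁅v0, u t⁆ := fun t => by
    have h1 : ⁅v0, u t⁆ = ∑ k ∈ Finset.range K,
        (t ^ (k + 1) * ((k + 1).factorial : ℂ)⁻¹) • (D ^ (k + 1)) v1 := by
      change D (u t) = _
      simp only [u, map_sum, map_smul, ← Module.End.mul_apply, ← pow_succ']
      rw [Finset.sum_range_succ, hv0]
      simp
    rw [h1, Finset.sum_range_succ']
    simp [add_comm v1]
  let φ : ℂ → g → ℂ := fun t x => χ x - χ ⁅u t, x⁆ + 2⁻¹ * χ ⁅u t, ⁅u t, x⁆⁆
  have hφ : ∀ t, ∀ x ∈ P, HasDerivAt (fun z => φ z x) (-φ t (N x)) t := fun t x hx => by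
    let b : g →ₗ[ℂ] ℂ :=
      { toFun := fun a => χ ⁅a, x⁆
        map_add' := fun _ _ => by simp
        map_smul' := fun _ _ => by simp }
    let B : g →ₗ[ℂ] g →ₗ[ℂ] ℂ := LinearMap.mk₂ ℂ (fun a a' => χ ⁅a, ⁅a', x⁆⁆)
      (fun _ _ _ => by simp) (fun _ _ _ => by simp) (fun _ _ _ => by simp)
      (fun _ _ _ => by simp)
    have h1 := hasDerivAt_linear_sum b (Finset.range (K + 1)) (fun k => (D ^ k) v1) _
      (fun k z => z ^ k * (k.factorial : ℂ)⁻¹) t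
      (fun k _ => hasDerivAt_pow_succ_div_factorial k t)
    have h2 := hasDerivAt_bilin_sum B (Finset.range (K + 1)) (fun k => (D ^ k) v1) _
      (fun k z => z ^ k * (k.factorial : ℂ)⁻¹) t
      (fun k _ => hasDerivAt_pow_succ_div_factorial k t)
    rw [hu' t] at h1 h2
    refine ((h1.const_sub (χ x)).add (h2.const_mul 2⁻¹)).congr_deriv ?_
    exact hode (u t) (huU t) x hx
  have hu0 : u 0 = 0 := by simp [u]
  refine ⟨u 1, huU 1, fun x hx => ?_⟩
  have := eq_exp_sum_of_hasDerivAt N P hP φ hφ (fun t => by simp [φ]) (K + 1) x hx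
    (by rw [hv]; rfl) 1
  simpa [φ, hu0] using this


set_option maxHeartbeats 1000000 in
/-- Under the conditions (★), the map
`σ̃₂ : g^{(1)}₁ → ñ₂*, v ↦ χ̃₂ + ad*(v)χ̃₂ + ½ ad*(v)² χ̃₂` is a bijection onto the
coadjoint orbit `Õ₂ = Ad*(Ñ₂)·χ̃₂`, and the restriction map `ñ₂* → ñ₁*` maps `Õ₂`
bijectively onto `Õ₁ = Ad*(Ñ₁)·χ̃₁`, intertwining `σ̃₂` with the Gan–Ginzburg
parametrization `σ̃₁ : v ↦ χ̃₁ + ad*(v)χ̃₁`.  Orbits of the unipotent groups are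
realized through exponentials of the coadjoint action (`ad*(v)ξ = -ξ ∘ ad v`). -/
theorem statement13
    (g : Type*) [LieRing g] [LieAlgebra ℂ g] [FiniteDimensional ℂ g]
    [LieAlgebra.IsSimple ℂ g]
    (Φ : g →ₗ[ℂ] g →ₗ[ℂ] ℂ)
    (hsymm : ∀ x y : g, Φ x y = Φ y x)
    (hinv : ∀ x y z : g, Φ ⁅x, y⁆ z = Φ x ⁅y, z⁆)
    (hnondeg : ∀ x : g, (∀ y : g, Φ x y = 0) → x = 0)
    (gr1 gr2 : ℤ → Submodule ℂ g)
    (hdec1 : DirectSum.IsInternal fun δ : ℤ => gr1 δ)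
    (hdec2 : DirectSum.IsInternal fun δ : ℤ => gr2 δ)
    (hbidec : DirectSum.IsInternal fun p : ℤ × ℤ => gr1 p.1 ⊓ gr2 p.2)
    (hbr1 : ∀ δ₁ δ₂ : ℤ, ∀ x ∈ gr1 δ₁, ∀ y ∈ gr1 δ₂, ⁅x, y⁆ ∈ gr1 (δ₁ + δ₂))
    (hbr2 : ∀ δ₁ δ₂ : ℤ, ∀ x ∈ gr2 δ₁, ∀ y ∈ gr2 δ₂, ⁅x, y⁆ ∈ gr2 (δ₁ + δ₂))
    (f1 f2 : g) (hf1 : f1 ∈ gr1 (-2)) (hf2 : f2 ∈ gr2 (-2))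
    (hgood1inj : ∀ δ : ℤ, 1 ≤ δ → ∀ x ∈ gr1 δ, ⁅f1, x⁆ = 0 → x = 0)
    (hgood1surj : ∀ δ : ℤ, δ ≤ 1 → ∀ y ∈ gr1 (δ - 2), ∃ x ∈ gr1 δ, ⁅f1, x⁆ = y)
    (hgood2inj : ∀ δ : ℤ, 1 ≤ δ → ∀ x ∈ gr2 δ, ⁅f2, x⁆ = 0 → x = 0)
    (hgood2surj : ∀ δ : ℤ, δ ≤ 1 → ∀ y ∈ gr2 (δ - 2), ∃ x ∈ gr2 δ, ⁅f2, x⁆ = y)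
    (hstar1 : (⨆ d : ℤ, ⨆ _ : (2 : ℤ) ≤ d, gr1 d) ≤ ⨆ d : ℤ, ⨆ _ : (1 : ℤ) ≤ d, gr2 d)
    (hstar2 : (⨆ d : ℤ, ⨆ _ : (1 : ℤ) ≤ d, gr2 d) ≤ ⨆ d : ℤ, ⨆ _ : (0 : ℤ) ≤ d, gr1 d)
    (hstar3 : gr1 1 ≤ (gr1 1 ⊓ gr2 0) ⊔ (gr1 1 ⊓ gr2 1) ⊔ (gr1 1 ⊓ gr2 2))
    (hstar4 : gr2 1 ≤ (gr2 1 ⊓ gr1 0) ⊔ (gr2 1 ⊓ gr1 1) ⊔ (gr2 1 ⊓ gr1 2))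
    (hstar5 : f2 - f1 ∈ gr1 0 ⊓ gr2 (-2))
    (aa : Submodule ℂ g)
    (ha1 : aa ≤ (gr2 1 ⊓ gr1 0) ⊓ LinearMap.ker (LieAlgebra.ad ℂ g f1 : g →ₗ[ℂ] g))
    (ha2 : ∀ u ∈ aa ⊔ (gr2 1 ⊓ gr1 2), ∀ v ∈ aa ⊔ (gr2 1 ⊓ gr1 2), Φ f2 ⁅u, v⁆ = 0)
    (ha3 : {v : g | v ∈ gr2 1 ∧ ∀ u ∈ aa ⊔ (gr2 1 ⊓ gr1 2), Φ f2 ⁅v, u⁆ = 0}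
        = ↑(aa ⊔ (gr2 1 ⊓ gr1 1) ⊔ (gr2 1 ⊓ gr1 2)))
    (n0 n1 n2 : Submodule ℂ g)
    (hn0 : n0 = aa ⊔ (gr1 0 ⊓ (⨆ d : ℤ, ⨆ _ : (2 : ℤ) ≤ d, gr2 d)))
    (hn1 : n1 = ((gr1 1 ⊓ gr2 1) ⊔ (gr1 1 ⊓ gr2 2)) ⊔ (⨆ d : ℤ, ⨆ _ : (2 : ℤ) ≤ d, gr1 d))
    (hn2 : n2 = (aa ⊔ (gr1 1 ⊓ gr2 1) ⊔ (gr1 2 ⊓ gr2 1)) ⊔ (⨆ d : ℤ, ⨆ _ : (2 : ℤ) ≤ d, gr2 d))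
    (nt1 nt2 : Submodule ℂ g)
    (hnt1 : nt1 = ⨆ d : ℤ, ⨆ _ : (1 : ℤ) ≤ d, gr1 d)
    (hnt2 : nt2 = nt1 ⊔ n0)
    (h12 : nt1 ≤ nt2)
    (K : ℕ) (hK : ∀ v ∈ nt2, (LieAlgebra.ad ℂ g v : Module.End ℂ g) ^ (K + 1) = 0) :
    let F : g → Module.Dual ℂ g := fun v =>
      ∑ k ∈ Finset.range (K + 1), ((-1 : ℂ) ^ k * ((k.factorial : ℂ))⁻¹) •
        ((Φ f2) ∘ₗ ((LieAlgebra.ad ℂ g v : Module.End ℂ g) ^ k : g →ₗ[ℂ] g))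
    let F1 : g → Module.Dual ℂ g := fun v =>
      ∑ k ∈ Finset.range (K + 1), ((-1 : ℂ) ^ k * ((k.factorial : ℂ))⁻¹) •
        ((Φ f1) ∘ₗ ((LieAlgebra.ad ℂ g v : Module.End ℂ g) ^ k : g →ₗ[ℂ] g))
    -- `σ̃₂` before restriction: `χ₂ + ad*(v)χ₂ + ½ ad*(v)²χ₂`
    let G : g → Module.Dual ℂ g := fun v =>
      ∑ k ∈ Finset.range 3, ((-1 : ℂ) ^ k * ((k.factorial : ℂ))⁻¹) •
        ((Φ f2) ∘ₗ ((LieAlgebra.ad ℂ g v : Module.End ℂ g) ^ k : g →ₗ[ℂ] g))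
    -- `σ̃₁` before restriction: `χ₁ + ad*(v)χ₁`
    let G1 : g → Module.Dual ℂ g := fun v =>
      ∑ k ∈ Finset.range 2, ((-1 : ℂ) ^ k * ((k.factorial : ℂ))⁻¹) •
        ((Φ f1) ∘ₗ ((LieAlgebra.ad ℂ g v : Module.End ℂ g) ^ k : g →ₗ[ℂ] g))
    let r2 : Module.Dual ℂ g →ₗ[ℂ] Module.Dual ℂ nt2 := LinearMap.dualMap nt2.subtype
    let r1 : Module.Dual ℂ g →ₗ[ℂ] Module.Dual ℂ nt1 := LinearMap.dualMap nt1.subtype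
    let p : Module.Dual ℂ nt2 →ₗ[ℂ] Module.Dual ℂ nt1 :=
      LinearMap.dualMap (Submodule.inclusion h12)
    let O2 : Set (Module.Dual ℂ nt2) := {ξ | ∃ v ∈ nt2, ξ = r2 (F v)}
    let O1 : Set (Module.Dual ℂ nt1) := {ξ | ∃ v ∈ nt1, ξ = r1 (F1 v)}
    -- `σ̃₂` is a bijection from `g^{(1)}₁` onto `Õ₂`
    Set.InjOn (fun v : g => r2 (G v)) ↑(gr1 1) ∧
    ((fun v : g => r2 (G v)) '' ↑(gr1 1) = O2) ∧
    -- the restriction map `ñ₂* → ñ₁*` maps `Õ₂` bijectively onto `Õ₁`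
    Set.InjOn p O2 ∧ (p '' O2 = O1) ∧
    -- intertwining with `σ̃₁`
    (∀ v ∈ gr1 1, p (r2 (G v)) = r1 (G1 v)) := by
  intro F F1 G G1 r2 r1 p O2 O1
  have hΦ1 : ∀ i j : ℤ, i + j ≠ 0 → ∀ x ∈ gr1 i, ∀ y ∈ gr1 j, Φ x y = 0 :=
    fun i j hij x hx y hy => invariantForm_eq_zero_of_add_ne_zero Φ hinv gr1 hdec1 hbr1 hij hx hy
  have hΦ2 : ∀ i j : ℤ, i + j ≠ 0 → ∀ x ∈ gr2 i, ∀ y ∈ gr2 j, Φ x y = 0 :=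
    fun i j hij x hx y hy => invariantForm_eq_zero_of_add_ne_zero Φ hinv gr2 hdec2 hbr2 hij hx hy
  obtain ⟨hf0, -⟩ := Submodule.mem_inf.mp hstar5
  have hχ : ∀ x, Φ f2 x = Φ f1 x + Φ (f2 - f1) x := fun x => by simp
  replace hstar1 : degreeGE gr1 2 ≤ degreeGE gr2 1 := hstar1
  replace hnt1 : nt1 = degreeGE gr1 1 := hnt1
  have hnt1' : nt1 = gr1 1 ⊔ degreeGE gr1 2 := by
    rw [hnt1]
    exact le_antisymm (degreeGE_le_sup gr1 1)
      (sup_le (le_degreeGE gr1 le_rfl) (degreeGE_anti gr1 (by norm_num)))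
  have hn0mem : ∀ a ∈ n0, ∃ b ∈ aa, ∃ c ∈ degreeGE gr2 2, c ∈ gr1 0 ∧ b + c = a := fun a ha => by
    rw [hn0] at ha
    obtain ⟨b, hb, c, hc, h⟩ := Submodule.mem_sup.mp ha
    exact ⟨b, hb, c, hc.2, hc.1, h⟩
  have haa : ∀ a ∈ aa, a ∈ gr2 1 ∧ a ∈ gr1 0 ∧ ⁅f1, a⁆ = 0 := fun a ha => by
    obtain ⟨⟨h1, h2⟩, h3⟩ := ha1 ha
    exact ⟨h1, h2, h3⟩
  have hn0gr : ∀ a ∈ n0, a ∈ gr1 0 := fun a ha => by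
    obtain ⟨b, hb, c, -, hc, rfl⟩ := hn0mem a ha
    exact add_mem (haa b hb).2.1 hc
  have hn0ge : ∀ a ∈ n0, a ∈ degreeGE gr2 1 := fun a ha => by
    obtain ⟨b, hb, c, hc, -, rfl⟩ := hn0mem a ha
    exact add_mem (le_degreeGE gr2 le_rfl (haa b hb).1) (degreeGE_anti gr2 (by norm_num) hc)
  have hn0lie : ∀ a ∈ n0, ∀ b ∈ n0, ⁅a, b⁆ ∈ n0 := fun a ha b hb => by
    rw [hn0]
    refine Submodule.mem_sup_right ⟨by simpa using hbr1 0 0 a (hn0gr a ha) b (hn0gr b hb), ?_⟩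
    exact lie_mem_degreeGE hbr2 (by norm_num) (hn0ge a ha) (hn0ge b hb)
  have hχ_one : ∀ x ∈ gr1 1, Φ f2 x = 0 := fun x hx => by
    rw [hχ, hΦ1 (-2) 1 (by norm_num) f1 hf1 x hx, hΦ1 0 1 (by norm_num) _ hf0 x hx, add_zero]
  have hχ_three : ∀ x ∈ degreeGE gr1 3, Φ f2 x = 0 := fun x hx => by
    rw [hχ, form_eq_zero_of_mem_degreeGE hΦ1 (by norm_num) hf1 hx,
      form_eq_zero_of_mem_degreeGE hΦ1 (by norm_num) hf0 hx, add_zero]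
  have hχ_lie {m n : ℤ} (hmn : 3 ≤ m + n) {a b : g} (ha : a ∈ degreeGE gr1 m)
      (hb : b ∈ degreeGE gr1 n) : Φ f2 ⁅a, b⁆ = 0 :=
    hχ_three _ (lie_mem_degreeGE hbr1 hmn ha hb)
  have hχ_three' : ∀ x ∈ degreeGE gr2 3, Φ f2 x = 0 := fun x hx =>
    form_eq_zero_of_mem_degreeGE hΦ2 (by norm_num) hf2 hx
  have hχ_pos : ∀ x ∈ degreeGE gr1 1, Φ f2 x = Φ f1 x := fun x hx => by
    rw [hχ, form_eq_zero_of_mem_degreeGE hΦ1 (by norm_num) hf0 hx, add_zero]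
  have hχ_zero_zero : ∀ a ∈ n0, ∀ b ∈ n0, Φ f2 ⁅a, b⁆ = 0 := fun a ha b hb => by
    obtain ⟨a1, ha1, a2, ha2', -, rfl⟩ := hn0mem a ha
    rw [add_lie, map_add,
      hχ_three' _ (lie_mem_degreeGE hbr2 (by norm_num) ha2' (hn0ge b hb)), add_zero]
    obtain ⟨b1, hb1, b2, hb2, -, rfl⟩ := hn0mem b hb
    rw [lie_add, map_add, ha2 _ (Submodule.mem_sup_left ha1) _ (Submodule.mem_sup_left hb1),
      zero_add]
    exact hχ_three' _ (lie_mem_degreeGE hbr2 (by norm_num)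
      (le_degreeGE gr2 le_rfl (haa a1 ha1).1) hb2)
  have hχ_zero_two : ∀ a ∈ n0, ∀ b ∈ degreeGE gr1 2, Φ f2 ⁅a, b⁆ = 0 := fun a ha b hb => by
    obtain ⟨a1, ha1, a2, ha2', -, rfl⟩ := hn0mem a ha
    rw [add_lie, map_add,
      hχ_three' _ (lie_mem_degreeGE hbr2 (by norm_num) ha2' (hstar1 hb)), add_zero]
    rw [hχ_pos _ (lie_mem_degreeGE hbr1 (by norm_num)
      (le_degreeGE gr1 le_rfl (haa a1 ha1).2.1) hb), ← hinv, (haa a1 ha1).2.2]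
    simp
  have hχ_two_zero : ∀ b ∈ degreeGE gr1 2, ∀ a ∈ n0, Φ f2 ⁅b, a⁆ = 0 := fun b hb a ha => by
    rw [← lie_skew, map_neg, hχ_zero_two a ha b hb, neg_zero]
  have hge0 : ∀ x ∈ gr1 0, x ∈ degreeGE gr1 0 := fun x hx => le_degreeGE gr1 le_rfl hx
  have hge1 : ∀ x ∈ gr1 1, x ∈ degreeGE gr1 1 := fun x hx => le_degreeGE gr1 le_rfl hx
  have hone_nt1 : ∀ x ∈ gr1 1, x ∈ nt1 := fun x hx => hnt1' ▸ Submodule.mem_sup_left hx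
  have htwo_nt1 : ∀ x ∈ degreeGE gr1 2, x ∈ nt1 := fun x hx => hnt1' ▸ Submodule.mem_sup_right hx
  have hnt1ge : ∀ x ∈ nt1, x ∈ degreeGE gr1 1 := fun x hx => hnt1 ▸ hx
  have hge_nt1 : ∀ x ∈ degreeGE gr1 1, x ∈ nt1 := fun x hx => hnt1 ▸ hx
  have hn0_nt2 : ∀ x ∈ n0, x ∈ nt2 := fun x hx => hnt2 ▸ Submodule.mem_sup_right hx
  have hnt2mem : ∀ x ∈ nt2, ∃ x0 ∈ n0, ∃ x1 ∈ gr1 1, ∃ x2 ∈ degreeGE gr1 2,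
      x = x0 + x1 + x2 := fun x hx => by
    rw [hnt2] at hx
    obtain ⟨y, hy, x0, hx0, rfl⟩ := Submodule.mem_sup.mp hx
    rw [hnt1'] at hy
    obtain ⟨x1, hx1, x2, hx2, rfl⟩ := Submodule.mem_sup.mp hy
    exact ⟨x0, hx0, x1, hx1, x2, hx2, by abel⟩
  have hnt2ge : ∀ x ∈ nt2, x ∈ degreeGE gr1 0 := fun x hx => by
    obtain ⟨x0, hx0, x1, hx1, x2, hx2, rfl⟩ := hnt2mem x hx
    exact add_mem (add_mem (hge0 _ (hn0gr _ hx0)) (le_degreeGE gr1 zero_le_one hx1))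
      (degreeGE_anti gr1 (by norm_num) hx2)
  have hnt2lie : ∀ v ∈ nt2, ∀ x ∈ nt2, ⁅v, x⁆ ∈ nt2 := fun v hv x hx => by
    have hvge := hnt2ge v hv
    rw [hnt2] at hv hx
    obtain ⟨y, hy, x0, hx0, rfl⟩ := Submodule.mem_sup.mp hx
    rw [lie_add]
    refine add_mem (h12 (hge_nt1 _ ?_)) ?_
    · exact lie_mem_degreeGE hbr1 (by norm_num) hvge (hnt1ge y hy)
    · obtain ⟨w, hw, v0, hv0, rfl⟩ := Submodule.mem_sup.mp hv
      rw [add_lie]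
      refine add_mem (h12 (hge_nt1 _ ?_)) (hn0_nt2 _ (hn0lie _ hv0 _ hx0))
      exact lie_mem_degreeGE hbr1 (by norm_num) (hnt1ge w hw) (hge0 _ (hn0gr _ hx0))
  have hG : ∀ v x, G v x = Φ f2 x - Φ f2 ⁅v, x⁆ + 2⁻¹ * Φ f2 ⁅v, ⁅v, x⁆⁆ := fun v x => by
    simp [G, Finset.sum_range_succ, pow_succ, sub_eq_add_neg]
  have hG1 : ∀ v x, G1 v x = Φ f1 x - Φ f1 ⁅v, x⁆ := fun v x => by
    simp [G1, Finset.sum_range_succ, sub_eq_add_neg]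
  have hF : ∀ v x, F v x = ∑ k ∈ Finset.range (K + 1), ((-1 : ℂ) ^ k * ((k.factorial : ℂ))⁻¹) *
      Φ f2 (((LieAlgebra.ad ℂ g v : Module.End ℂ g) ^ k) x) := fun v x => by
    simp [F, LinearMap.sum_apply]
  have htrunc : ∀ (f v x : g) (n : ℕ), v ∈ nt2 →
      (∀ k, n ≤ k → Φ f (((LieAlgebra.ad ℂ g v : Module.End ℂ g) ^ k) x) = 0) →
      (∑ k ∈ Finset.range (K + 1), ((-1 : ℂ) ^ k * ((k.factorial : ℂ))⁻¹) •
        ((Φ f) ∘ₗ ((LieAlgebra.ad ℂ g v : Module.End ℂ g) ^ k : g →ₗ[ℂ] g))) x =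
      (∑ k ∈ Finset.range n, ((-1 : ℂ) ^ k * ((k.factorial : ℂ))⁻¹) •
        ((Φ f) ∘ₗ ((LieAlgebra.ad ℂ g v : Module.End ℂ g) ^ k : g →ₗ[ℂ] g))) x := by
    intro f v x n hv hzero
    simp only [LinearMap.sum_apply, LinearMap.smul_apply, LinearMap.comp_apply]
    have hzero' : ∀ k, K + 1 ≤ k →
        Φ f (((LieAlgebra.ad ℂ g v : Module.End ℂ g) ^ k) x) = 0 := fun k hk => by
      rw [pow_eq_zero_of_le hk (hK v hv)]
      simp
    rw [Finset.sum_subset (Finset.range_mono (le_max_left (K + 1) n)),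
      Finset.sum_subset (Finset.range_mono (le_max_right (K + 1) n))]
    · intro k _ hk
      rw [hzero k (by simpa using hk), smul_zero]
    · intro k _ hk
      rw [hzero' k (by simpa using hk), smul_zero]
  have hFG : ∀ v ∈ gr1 1, ∀ x ∈ nt2, F v x = G v x := fun v hv x hx => by
    refine htrunc f2 v x 3 (h12 (hone_nt1 v hv)) fun k hk => hχ_three _ ?_
    exact degreeGE_anti gr1 (by lia) (ad_pow_mem_degreeGE hbr1 (hge1 v hv) (hnt2ge x hx) k)
  have hF1 : ∀ v ∈ gr1 1, ∀ w ∈ degreeGE gr1 2, ∀ x ∈ nt1, F1 (v + w) x = G1 v x := by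
    intro v hv w hw x hx
    have hvw : v + w ∈ nt1 := add_mem (hone_nt1 v hv) (htwo_nt1 w hw)
    have h3 : ∀ y ∈ degreeGE gr1 3, Φ f1 y = 0 := fun y hy =>
      form_eq_zero_of_mem_degreeGE hΦ1 (by norm_num) hf1 hy
    have h : F1 (v + w) x = G1 (v + w) x := by
      refine htrunc f1 (v + w) x 2 (h12 hvw) fun k hk => h3 _ ?_
      exact degreeGE_anti gr1 (by lia)
        (ad_pow_mem_degreeGE hbr1 (hnt1ge _ hvw) (hnt1ge x hx) k)
    rw [h, hG1, hG1, add_lie, map_add,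
      h3 _ (lie_mem_degreeGE hbr1 (by norm_num) hw (hnt1ge x hx)), add_zero]
  have hGG1 : ∀ v ∈ gr1 1, ∀ x ∈ nt1, G v x = G1 v x := fun v hv x hx => by
    have h1 : ⁅v, x⁆ ∈ degreeGE gr1 2 :=
      lie_mem_degreeGE hbr1 (by norm_num) (hge1 v hv) (hnt1ge x hx)
    rw [hG, hG1, hχ_lie (by norm_num) (hge1 v hv) h1, hχ_pos x (hnt1ge x hx),
      hχ_pos _ (degreeGE_anti gr1 (by norm_num) h1)]
    ring
  have hG1inj : ∀ v ∈ gr1 1, ∀ w ∈ gr1 1, (∀ x ∈ nt1, G1 v x = G1 w x) → v = w := by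
    intro v hv w hw h
    rw [← sub_eq_zero]
    have hvw : v - w ∈ gr1 1 := sub_mem hv hw
    refine hgood1inj 1 le_rfl _ hvw (hnondeg _ fun y => ?_)
    have hmem : ⁅f1, v - w⁆ ∈ gr1 (-1) := hbr1 (-2) 1 f1 hf1 _ hvw
    have hy : y ∈ ⨆ i, gr1 i := hdec1.submodule_iSup_eq_top ▸ Submodule.mem_top
    induction hy using Submodule.iSup_induction' with
    | zero => simp
    | add a b _ _ ha hb => rw [map_add, ha, hb, add_zero]
    | mem i y hy =>
      by_cases hi : i = 1
      · subst hi
        have := h y (hone_nt1 y hy)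
        rw [hG1, hG1] at this
        rw [hinv, sub_lie, map_sub]
        linear_combination -this
      · exact hΦ1 (-1) i (by lia) _ hmem y hy
  have hFexists : ∀ v ∈ nt2, ∃ u ∈ gr1 1, ∀ x ∈ nt2, G u x = F v x := by
    intro v hv
    obtain ⟨v0, hv0, v1, hv1, v2, hv2, hvsum⟩ := hnt2mem v hv
    have hU : ∀ u ∈ gr1 1, ⁅v0, u⁆ ∈ gr1 1 := fun u hu => hbr1 0 1 v0 (hn0gr v0 hv0) u hu
    simp only [hG, hF]
    refine exists_quadratic_eq_exp (Φ f2) nt2 (gr1 1) v v0 v1 K (hK v hv)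
      (hK v0 (hn0_nt2 v0 hv0)) (hnt2lie v hv) hU hv1 fun u hu x hx => ?_
    obtain ⟨x0, hx0, x1, hx1, x2, hx2, rfl⟩ := hnt2mem x hx
    have hu1 := hge1 u hu
    have hw : v1 + ⁅v0, u⁆ ∈ gr1 1 := add_mem hv1 (hU u hu)
    have hw1 := hge1 _ hw
    have hvge := hnt2ge v hv
    have lie_mem {m n : ℤ} {a b : g} :=
      lie_mem_degreeGE_add hbr1 (m := m) (n := n) (x := a) (y := b)
    have e2 : -Φ f2 ⁅v1 + ⁅v0, u⁆, x2⁆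
          + 2⁻¹ * (Φ f2 ⁅v1 + ⁅v0, u⁆, ⁅u, x2⁆⁆ + Φ f2 ⁅u, ⁅v1 + ⁅v0, u⁆, x2⁆⁆)
        = -(Φ f2 ⁅v, x2⁆ - Φ f2 ⁅u, ⁅v, x2⁆⁆ + 2⁻¹ * Φ f2 ⁅u, ⁅u, ⁅v, x2⁆⁆⁆) := by
      have hv2x : Φ f2 ⁅v, x2⁆ = 0 := by
        rw [hvsum, add_lie, add_lie, map_add, map_add, hχ_zero_two v0 hv0 x2 hx2,
          hχ_lie (by norm_num) (hge1 v1 hv1) hx2,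
          hχ_lie (by norm_num) hv2 hx2]
        simp
      rw [hv2x, hχ_lie (by norm_num) hw1 hx2,
        hχ_lie (by norm_num) hw1 (lie_mem hu1 hx2),
        hχ_lie (by norm_num) hu1 (lie_mem hw1 hx2),
        hχ_lie (by norm_num) hu1 (lie_mem hvge hx2),
        hχ_lie (by norm_num) hu1 (lie_mem hu1 (lie_mem hvge hx2))]
      simp
    have e1 : -Φ f2 ⁅v1 + ⁅v0, u⁆, x1⁆
          + 2⁻¹ * (Φ f2 ⁅v1 + ⁅v0, u⁆, ⁅u, x1⁆⁆ + Φ f2 ⁅u, ⁅v1 + ⁅v0, u⁆, x1⁆⁆)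
        = -(Φ f2 ⁅v, x1⁆ - Φ f2 ⁅u, ⁅v, x1⁆⁆ + 2⁻¹ * Φ f2 ⁅u, ⁅u, ⁅v, x1⁆⁆⁆) := by
      have hx1' := hge1 x1 hx1
      rw [hχ_lie (by norm_num) hw1 (lie_mem hu1 hx1'), hχ_lie (by norm_num) hu1 (lie_mem hw1 hx1'),
        hχ_lie (by norm_num) hu1 (lie_mem hu1 (lie_mem hvge hx1'))]
      have h1 : Φ f2 ⁅v, x1⁆ = Φ f2 ⁅v1, x1⁆ := by
        rw [hvsum, add_lie, add_lie, map_add, map_add, hχ_one _ (hU x1 hx1),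
          hχ_lie (by norm_num) hv2 hx1']
        simp
      have h2 : Φ f2 ⁅u, ⁅v, x1⁆⁆ = Φ f2 ⁅u, ⁅v0, x1⁆⁆ := by
        rw [hvsum]
        simp only [add_lie, lie_add, map_add]
        rw [hχ_lie (by norm_num) hu1 (lie_mem (hge1 v1 hv1) hx1'),
          hχ_lie (by norm_num) hu1 (lie_mem hv2 hx1')]
        simp
      have h3 := hχ_zero_two v0 hv0 _ (lie_mem_degreeGE hbr1 (by norm_num) hu1 hx1')
      rw [leibniz_lie, map_add] at h3
      rw [h1, h2, add_lie, map_add]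
      linear_combination -h3
    have e0 : -Φ f2 ⁅v1 + ⁅v0, u⁆, x0⁆
          + 2⁻¹ * (Φ f2 ⁅v1 + ⁅v0, u⁆, ⁅u, x0⁆⁆ + Φ f2 ⁅u, ⁅v1 + ⁅v0, u⁆, x0⁆⁆)
        = -(Φ f2 ⁅v, x0⁆ - Φ f2 ⁅u, ⁅v, x0⁆⁆ + 2⁻¹ * Φ f2 ⁅u, ⁅u, ⁅v, x0⁆⁆⁆) := by
      have hx0g := hn0gr x0 hx0
      have hx0' := hge0 x0 hx0g
      have hone : ∀ a ∈ gr1 1, ∀ b ∈ gr1 0, Φ f2 ⁅a, b⁆ = 0 := fun a ha b hb =>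
        hχ_one _ (hbr1 1 0 a ha b hb)
      have h00 : ⁅v0, x0⁆ ∈ gr1 0 := hbr1 0 0 v0 (hn0gr v0 hv0) x0 hx0g
      have h1 : Φ f2 ⁅v, x0⁆ = 0 := by
        rw [hvsum, add_lie, add_lie, map_add, map_add, hχ_zero_zero v0 hv0 x0 hx0,
          hone v1 hv1 x0 hx0g, hχ_two_zero v2 hv2 x0 hx0]
        simp
      have h2 : Φ f2 ⁅u, ⁅v, x0⁆⁆ = Φ f2 ⁅u, ⁅v1, x0⁆⁆ := by
        rw [hvsum]
        simp only [add_lie, lie_add, map_add]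
        rw [hone u hu _ h00, hχ_lie (by norm_num) hu1 (lie_mem hv2 hx0')]
        simp
      have h3 : Φ f2 ⁅u, ⁅u, ⁅v, x0⁆⁆⁆ = Φ f2 ⁅u, ⁅u, ⁅v0, x0⁆⁆⁆ := by
        rw [hvsum]
        simp only [add_lie, lie_add, map_add]
        rw [hχ_lie (by norm_num) hu1 (lie_mem hu1 (lie_mem (hge1 v1 hv1) hx0')),
          hχ_lie (by norm_num) hu1 (lie_mem hu1 (lie_mem hv2 hx0'))]
        simp
      have h4 := hχ_zero_two v0 hv0 _
        (lie_mem_degreeGE hbr1 (by norm_num) hu1 (lie_mem hu1 hx0'))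
      rw [leibniz_lie v0 u, leibniz_lie v0 u x0, lie_add, map_add, map_add] at h4
      have h5 := hχ_two_zero _
        (lie_mem_degreeGE hbr1 (by norm_num) (hge1 v1 hv1) hu1) x0 hx0
      rw [lie_lie, map_sub] at h5
      rw [h1, h2, h3, hone _ hw x0 hx0g]
      simp only [add_lie, lie_add, map_add]
      linear_combination 2⁻¹ * h4 + 2⁻¹ * h5
    simp only [lie_add, map_add] at e0 e1 e2 ⊢
    linear_combination e0 + e1 + e2
  have hinter : ∀ v ∈ gr1 1, p (r2 (G v)) = r1 (G1 v) := fun v hv =>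
    LinearMap.ext fun x => hGG1 v hv x x.2
  have hr1inj : ∀ v ∈ gr1 1, ∀ w ∈ gr1 1, r1 (G1 v) = r1 (G1 w) → v = w := fun v hv w hw h =>
    hG1inj v hv w hw fun x hx => LinearMap.congr_fun h ⟨x, hx⟩
  have hO2 : (fun v : g => r2 (G v)) '' ↑(gr1 1) = O2 := by
    ext ξ
    constructor
    · rintro ⟨v, hv, rfl⟩
      exact ⟨v, h12 (hone_nt1 v hv), LinearMap.ext fun x => (hFG v hv x x.2).symm⟩
    · rintro ⟨v, hv, rfl⟩
      obtain ⟨u, hu, h⟩ := hFexists v hv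
      exact ⟨u, hu, LinearMap.ext fun x => h x x.2⟩
  refine ⟨fun v hv w hw h => hr1inj v hv w hw ?_, hO2, ?_, ?_, hinter⟩
  · rw [← hinter v hv, ← hinter w hw]
    exact congrArg p h
  · rw [← hO2]
    rintro _ ⟨v, hv, rfl⟩ _ ⟨w, hw, rfl⟩ h
    simp only [hinter v hv, hinter w hw] at h
    rw [hr1inj v hv w hw h]
  · rw [← hO2]
    ext ξ
    constructor
    · rintro ⟨_, ⟨v, hv, rfl⟩, rfl⟩
      refine ⟨v, hone_nt1 v hv, (hinter v hv).trans (LinearMap.ext fun x => ?_)⟩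
      have := hF1 v hv 0 (zero_mem _) x x.2
      rw [add_zero] at this
      exact this.symm
    · rintro ⟨v, hv, rfl⟩
      rw [hnt1'] at hv
      obtain ⟨v1, hv1, v2, hv2, rfl⟩ := Submodule.mem_sup.mp hv
      exact ⟨_, ⟨v1, hv1, rfl⟩, (hinter v1 hv1).trans
        (LinearMap.ext fun x => (hF1 v1 hv1 v2 hv2 x x.2).symm)⟩
end
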